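/- Suppose in addition that d ≥ n, that d is invertible in 𝕜, and that 𝕜 contains a primitive d-th root of unity ξ. Then: (a) there is an injective 𝕜-algebra homomorphism ε : E^ord_n(q) → Y_{d,n}(q) with ε(g_a) = g_a and ε(ē(A^ord)) = Σ_{j ∈ J_{A^ord}} e(j) for all A^ord ∈ OrdSetPar_n; and (b) there is an injective 𝕜-algebra homomorphism ε₁ : E′_n(q) → E^ord_n(q) with ε₁(g_a) = g_a and ε₁(ē(A)) = Σ ē(B^ord), the sum over all B^ord ∈ OrdSetPar_n whose underlying set partition is A. -/

import Mathlib

open scoped Classical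

noncomputable section

namespace YH

/-- Generators of the Yokonuma–Hecke algebra (0-based indexing):
`g a h` corresponds to the generator `g_{a+1}` of the paper, and `t a` to `t_{a+1}`. -/
inductive Gen (n : ℕ) : Type
  | g : (a : ℕ) → a + 1 < n → Gen n
  | t : Fin n → Gen n

variable (𝕜 : Type) [Field 𝕜] (d n : ℕ) (q : 𝕜)

/-- The free algebra on the generators. -/
abbrev F : Type := FreeAlgebra 𝕜 (Gen n)

def G (a : ℕ) (h : a + 1 < n) : F 𝕜 n := FreeAlgebra.ι 𝕜 (Gen.g a h)

def T (a : Fin n) : F 𝕜 n := FreeAlgebra.ι 𝕜 (Gen.t a)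

/-- The simple transposition `σ_a = (a, a+1)` (0-based). -/
def sw (a : ℕ) (h : a + 1 < n) : Equiv.Perm (Fin n) :=
  Equiv.swap ⟨a, by omega⟩ ⟨a + 1, h⟩

/-- The element `e_a = (1/d) Σ_{r=0}^{d-1} t_a^r t_{a+1}^{-r}` of the free algebra, where
`t_{a+1}^{-r}` is represented by `t_{a+1}^{(d-r) % d}` (they agree once `t^d = 1` is imposed). -/
def Efree (a : ℕ) (h : a + 1 < n) : F 𝕜 n :=
  (d : 𝕜)⁻¹ • ∑ r ∈ Finset.range d,
    T 𝕜 n ⟨a, by omega⟩ ^ r * T 𝕜 n ⟨a + 1, h⟩ ^ ((d - r) % d)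

/-- The defining relations of the Yokonuma–Hecke algebra `Y_{d,n}(q)`. -/
inductive Rel : F 𝕜 n → F 𝕜 n → Prop
  | torder (a : Fin n) : Rel (T 𝕜 n a ^ d) 1
  | tcomm (a b : Fin n) : Rel (T 𝕜 n a * T 𝕜 n b) (T 𝕜 n b * T 𝕜 n a)
  | tg (a : Fin n) (b : ℕ) (hb : b + 1 < n) :
      Rel (T 𝕜 n a * G 𝕜 n b hb) (G 𝕜 n b hb * T 𝕜 n (sw n b hb a))
  | quad (a : ℕ) (h : a + 1 < n) :
      Rel (G 𝕜 n a h ^ 2)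
        (algebraMap 𝕜 (F 𝕜 n) q + (q - 1) • (Efree 𝕜 d n a h * G 𝕜 n a h))
  | braid (a : ℕ) (h : a + 2 < n) :
      Rel (G 𝕜 n a (by omega) * G 𝕜 n (a + 1) h * G 𝕜 n a (by omega))
        (G 𝕜 n (a + 1) h * G 𝕜 n a (by omega) * G 𝕜 n (a + 1) h)
  | gcomm (a b : ℕ) (ha : a + 1 < n) (hb : b + 1 < n) (hab : a + 1 < b) :
      Rel (G 𝕜 n a ha * G 𝕜 n b hb) (G 𝕜 n b hb * G 𝕜 n a ha)

/-- The Yokonuma–Hecke algebra `Y_{d,n}(q)`. -/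
abbrev Y : Type := RingQuot (Rel 𝕜 d n q)

def π : F 𝕜 n →ₐ[𝕜] Y 𝕜 d n q := RingQuot.mkAlgHom 𝕜 (Rel 𝕜 d n q)

/-- The generator `g_{a+1}` of `Y_{d,n}(q)` (0-based: `g a h`). -/
def g (a : ℕ) (h : a + 1 < n) : Y 𝕜 d n q := π 𝕜 d n q (G 𝕜 n a h)

/-- The generator `t_{a+1}` of `Y_{d,n}(q)` (0-based: `t a`). -/
def t (a : Fin n) : Y 𝕜 d n q := π 𝕜 d n q (T 𝕜 n a)

/-- The idempotent `e_a` in `Y_{d,n}(q)`. -/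
def eA (a : ℕ) (h : a + 1 < n) : Y 𝕜 d n q := π 𝕜 d n q (Efree 𝕜 d n a h)

/-- `(1/d) Σ_{r=0}^{d-1} t_a^r t_b^{-r}` in `Y_{d,n}(q)`, with `t_b^{-r}` written
`t_b^{(d-r) % d}`. -/
def eabAux (a b : Fin n) : Y 𝕜 d n q :=
  (d : 𝕜)⁻¹ • ∑ r ∈ Finset.range d, t 𝕜 d n q a ^ r * t 𝕜 d n q b ^ ((d - r) % d)

/-- The element `e_{ab}` (symmetrized so that `e_{ba} = e_{ab}`). -/
def eab (a b : Fin n) : Y 𝕜 d n q :=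
  if (a : ℕ) ≤ (b : ℕ) then eabAux 𝕜 d n q a b else eabAux 𝕜 d n q b a

/-- Set partitions of `{1, …, n}` are identified with equivalence relations, i.e. with
`Setoid (Fin n)`; `a ∼_A b` is `A.r a b`. -/
abbrev SetPar (n : ℕ) := Setoid (Fin n)

/-- `e(A) = ∏_{a ∼_A b, a ≠ b} e_{ab}` (the factors commute, so the product may be
taken in any fixed order). -/
def eSet (A : Setoid (Fin n)) : Y 𝕜 d n q :=
  (((List.finRange n) ×ˢ (List.finRange n)).map
    (fun p => if A.r p.1 p.2 ∧ p.1 ≠ p.2 then eab 𝕜 d n q p.1 p.2 else 1)).prod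

/-- `e(j) = ∏_{a=1}^n ((1/d) Σ_{r=0}^{d-1} ξ^{-j_a r} t_a^r)` for `j ∈ (ℤ/dℤ)^n`. -/
def ej (ξ : 𝕜) (j : Fin n → ZMod d) : Y 𝕜 d n q :=
  ((List.finRange n).map (fun a =>
    (d : 𝕜)⁻¹ • ∑ r ∈ Finset.range d,
      ξ ^ (((-(j a)) * (r : ZMod d)).val) • t 𝕜 d n q a ^ r)).prod

/-- `J_A = { j ∈ (ℤ/dℤ)^n : j_a = j_b ⇔ a ∼_A b }`. -/
def JA [NeZero d] (A : Setoid (Fin n)) : Finset (Fin n → ZMod d) :=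
  Finset.univ.filter (fun j => ∀ a b : Fin n, j a = j b ↔ A.r a b)

/-- `ē(A) = Σ_{j ∈ J_A} e(j)`. -/
def ebar [NeZero d] (ξ : 𝕜) (A : Setoid (Fin n)) : Y 𝕜 d n q :=
  ∑ j ∈ JA d n A, ej 𝕜 d n q ξ j

/-- The Jucys–Murphy elements: `X 0 = X_1 = 1` and `X (a+1) = X_{a+2} = q⁻¹ g_{a+1} X_{a+1} g_{a+1}`
(0-based indexing: `X a h` is the paper's `X_{a+1}`). -/
def X : (a : ℕ) → a < n → Y 𝕜 d n q
  | 0, _ => 1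
  | a + 1, h => q⁻¹ • (g 𝕜 d n q a h * X a (by omega) * g 𝕜 d n q a h)

/-- The action of a permutation on set partitions (equivalence relations). -/
def permSetoid (σ : Equiv.Perm (Fin n)) (A : Setoid (Fin n)) : Setoid (Fin n) where
  r x y := A.r (σ.symm x) (σ.symm y)
  iseqv := ⟨fun _ => A.iseqv.refl _, fun h => A.iseqv.symm h, fun h h' => A.iseqv.trans h h'⟩

instance : Finite (Setoid (Fin n)) :=
  Finite.of_injective (fun A : Setoid (Fin n) => A.r)
    (fun A B h => by cases A; cases B; simp only at h; subst h; rfl)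

noncomputable instance : Fintype (Setoid (Fin n)) := Fintype.ofFinite _

end YH

namespace BTP

/-- Generators of the algebra `E′_n(q)` (0-based indexing). -/
inductive Gen (n : ℕ) : Type
  | g : (a : ℕ) → a + 1 < n → Gen n
  | eb : Setoid (Fin n) → Gen n

variable (𝕜 : Type) [Field 𝕜] (n : ℕ) (q : 𝕜)

abbrev F : Type := FreeAlgebra 𝕜 (Gen n)

def G (a : ℕ) (h : a + 1 < n) : F 𝕜 n := FreeAlgebra.ι 𝕜 (Gen.g a h)

def EB (A : Setoid (Fin n)) : F 𝕜 n := FreeAlgebra.ι 𝕜 (Gen.eb A)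

/-- The defining relations of `E′_n(q)`. -/
inductive Rel : F 𝕜 n → F 𝕜 n → Prop
  | unit : Rel (∑ A : Setoid (Fin n), EB 𝕜 n A) 1
  | orth (A C : Setoid (Fin n)) :
      Rel (EB 𝕜 n A * EB 𝕜 n C) (if A = C then EB 𝕜 n A else 0)
  | gmove (a : ℕ) (h : a + 1 < n) (A : Setoid (Fin n)) :
      Rel (G 𝕜 n a h * EB 𝕜 n A) (EB 𝕜 n (YH.permSetoid n (YH.sw n a h) A) * G 𝕜 n a h)
  | sqn (a : ℕ) (h : a + 1 < n) (A : Setoid (Fin n))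
      (hA : ¬ A.r ⟨a, by omega⟩ ⟨a + 1, h⟩) :
      Rel (G 𝕜 n a h ^ 2 * EB 𝕜 n A) (q • EB 𝕜 n A)
  | sqy (a : ℕ) (h : a + 1 < n) (A : Setoid (Fin n))
      (hA : A.r ⟨a, by omega⟩ ⟨a + 1, h⟩) :
      Rel (G 𝕜 n a h ^ 2 * EB 𝕜 n A)
        ((algebraMap 𝕜 (F 𝕜 n) q + (q - 1) • G 𝕜 n a h) * EB 𝕜 n A)
  | braid (a : ℕ) (h : a + 2 < n) :
      Rel (G 𝕜 n a (by omega) * G 𝕜 n (a + 1) h * G 𝕜 n a (by omega))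
        (G 𝕜 n (a + 1) h * G 𝕜 n a (by omega) * G 𝕜 n (a + 1) h)
  | gfar (a b : ℕ) (ha : a + 1 < n) (hb : b + 1 < n) (hab : a + 1 < b) :
      Rel (G 𝕜 n a ha * G 𝕜 n b hb) (G 𝕜 n b hb * G 𝕜 n a ha)

/-- The algebra `E′_n(q)`. -/
abbrev E : Type := RingQuot (Rel 𝕜 n q)

def π : F 𝕜 n →ₐ[𝕜] E 𝕜 n q := RingQuot.mkAlgHom 𝕜 (Rel 𝕜 n q)

def g (a : ℕ) (h : a + 1 < n) : E 𝕜 n q := π 𝕜 n q (G 𝕜 n a h)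

def ebar (A : Setoid (Fin n)) : E 𝕜 n q := π 𝕜 n q (EB 𝕜 n A)

end BTP

namespace BTO

/-- An ordered set partition of `{1, …, n}`, encoded as the function sending each element to
the (0-based) index of its block: the (downward closure) condition says that the image of `f`
is an initial segment `{0, …, k−1}`, whose fibers are the blocks `A_1, …, A_k` in order. -/
def OrdSetPar (n : ℕ) : Type :=
  {f : Fin n → Fin n // ∀ m : ℕ, (∃ x, (f x : ℕ) = m + 1) → ∃ x, (f x : ℕ) = m}

instance (n : ℕ) : Finite (OrdSetPar n) := Subtype.finite

noncomputable instance (n : ℕ) : Fintype (OrdSetPar n) := Fintype.ofFinite _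

/-- The action of a permutation on ordered set partitions. -/
def ordPerm {n : ℕ} (σ : Equiv.Perm (Fin n)) (A : OrdSetPar n) : OrdSetPar n :=
  ⟨fun x => A.1 (σ.symm x), by
    intro m hm
    obtain ⟨x, hx⟩ := hm
    obtain ⟨y, hy⟩ := A.2 m ⟨σ.symm x, hx⟩
    exact ⟨σ y, by simpa using hy⟩⟩

/-- The underlying (unordered) set partition of an ordered set partition. -/
def toSetoid {n : ℕ} (A : OrdSetPar n) : Setoid (Fin n) := Setoid.ker A.1

/-- Generators of the ordered bt-algebra `E^ord_n(q)`. -/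
inductive Gen (n : ℕ) : Type
  | g : (a : ℕ) → a + 1 < n → Gen n
  | eo : OrdSetPar n → Gen n

variable (𝕜 : Type) [Field 𝕜] (n : ℕ) (q : 𝕜)

abbrev F : Type := FreeAlgebra 𝕜 (Gen n)

def G (a : ℕ) (h : a + 1 < n) : F 𝕜 n := FreeAlgebra.ι 𝕜 (Gen.g a h)

def EO (A : OrdSetPar n) : F 𝕜 n := FreeAlgebra.ι 𝕜 (Gen.eo A)

/-- The defining relations of the ordered bt-algebra `E^ord_n(q)`. -/
inductive Rel : F 𝕜 n → F 𝕜 n → Prop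
  | unit : Rel (∑ A : OrdSetPar n, EO 𝕜 n A) 1
  | orth (A C : OrdSetPar n) :
      Rel (EO 𝕜 n A * EO 𝕜 n C) (if A = C then EO 𝕜 n A else 0)
  | gmove (a : ℕ) (h : a + 1 < n) (A : OrdSetPar n) :
      Rel (G 𝕜 n a h * EO 𝕜 n A) (EO 𝕜 n (ordPerm (YH.sw n a h) A) * G 𝕜 n a h)
  | sqn (a : ℕ) (h : a + 1 < n) (A : OrdSetPar n)
      (hA : A.1 ⟨a, by omega⟩ ≠ A.1 ⟨a + 1, h⟩) :
      Rel (G 𝕜 n a h ^ 2 * EO 𝕜 n A) (q • EO 𝕜 n A)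
  | sqy (a : ℕ) (h : a + 1 < n) (A : OrdSetPar n)
      (hA : A.1 ⟨a, by omega⟩ = A.1 ⟨a + 1, h⟩) :
      Rel (G 𝕜 n a h ^ 2 * EO 𝕜 n A)
        ((algebraMap 𝕜 (F 𝕜 n) q + (q - 1) • G 𝕜 n a h) * EO 𝕜 n A)
  | braid (a : ℕ) (h : a + 2 < n) :
      Rel (G 𝕜 n a (by omega) * G 𝕜 n (a + 1) h * G 𝕜 n a (by omega))
        (G 𝕜 n (a + 1) h * G 𝕜 n a (by omega) * G 𝕜 n (a + 1) h)
  | gfar (a b : ℕ) (ha : a + 1 < n) (hb : b + 1 < n) (hab : a + 1 < b) :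
      Rel (G 𝕜 n a ha * G 𝕜 n b hb) (G 𝕜 n b hb * G 𝕜 n a ha)

/-- The ordered bt-algebra `E^ord_n(q)`. -/
abbrev E : Type := RingQuot (Rel 𝕜 n q)

def π : F 𝕜 n →ₐ[𝕜] E 𝕜 n q := RingQuot.mkAlgHom 𝕜 (Rel 𝕜 n q)

def g (a : ℕ) (h : a + 1 < n) : E 𝕜 n q := π 𝕜 n q (G 𝕜 n a h)

def ebar (A : OrdSetPar n) : E 𝕜 n q := π 𝕜 n q (EO 𝕜 n A)

/-- `J_{A^ord}`: the set of `j ∈ (ℤ/dℤ)^n` that are constant on each block of `A^ord`,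
take pairwise distinct values on distinct blocks, and (identifying `ℤ/dℤ` with
`{0, …, d−1}`) whose values are strictly increasing along the ordered blocks. -/
def JOrd (d : ℕ) [NeZero d] {n : ℕ} (A : OrdSetPar n) : Finset (Fin n → ZMod d) :=
  Finset.univ.filter (fun j =>
    (∀ x y : Fin n, A.1 x = A.1 y → j x = j y)
    ∧ (∀ x y : Fin n, A.1 x ≠ A.1 y → j x ≠ j y)
    ∧ (∀ x y : Fin n, A.1 x < A.1 y → (j x).val < (j y).val))

end BTO

namespace BTAux

variable {n : ℕ}

lemma sw_left (a : ℕ) (h : a + 1 < n) : YH.sw n a h ⟨a, by omega⟩ = ⟨a + 1, h⟩ :=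
  Equiv.swap_apply_left _ _

lemma sw_right (a : ℕ) (h : a + 1 < n) : YH.sw n a h ⟨a + 1, h⟩ = ⟨a, by omega⟩ :=
  Equiv.swap_apply_right _ _

lemma sw_of_ne (a : ℕ) (h : a + 1 < n) (c : Fin n) (h1 : (c : ℕ) ≠ a) (h2 : (c : ℕ) ≠ a + 1) :
    YH.sw n a h c = c :=
  Equiv.swap_apply_of_ne_of_ne (fun e => h1 (by simp [e])) (fun e => h2 (by simp [e]))

lemma sw_mul_self (a : ℕ) (h : a + 1 < n) : YH.sw n a h * YH.sw n a h = 1 :=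
  Equiv.swap_mul_self _ _

lemma mul_sw_mul_sw (p : Equiv.Perm (Fin n)) (a : ℕ) (h : a + 1 < n) :
    p * YH.sw n a h * YH.sw n a h = p := by
  rw [mul_assoc, sw_mul_self, mul_one]

lemma sw_inv (a : ℕ) (h : a + 1 < n) : (YH.sw n a h)⁻¹ = YH.sw n a h :=
  Equiv.swap_inv _ _

lemma sw_symm (a : ℕ) (h : a + 1 < n) : (YH.sw n a h).symm = YH.sw n a h :=
  Equiv.symm_swap _ _

lemma sw_braid (a : ℕ) (h : a + 2 < n) :
    YH.sw n a (by omega) * YH.sw n (a + 1) h * YH.sw n a (by omega)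
      = YH.sw n (a + 1) h * YH.sw n a (by omega) * YH.sw n (a + 1) h := by
  have h1 := sw_left a (by omega : a + 1 < n)
  have h2 := sw_right a (by omega : a + 1 < n)
  have h3 := sw_left (a + 1) h
  have h4 := sw_right (a + 1) h
  have h5 := sw_of_ne a (by omega : a + 1 < n) ⟨a + 2, h⟩ (by simp) (by simp)
  have h6 := sw_of_ne (a + 1) h ⟨a, by omega⟩ (by simp) (by simp; omega)
  ext c : 1
  simp only [Equiv.Perm.mul_apply]
  by_cases c0 : (c : ℕ) = a
  · rw [show c = ⟨a, by omega⟩ from Fin.ext c0, h1, h6, h1, h3, h5]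
  by_cases c1 : (c : ℕ) = a + 1
  · rw [show c = ⟨a + 1, by omega⟩ from Fin.ext c1, h2, h6, h1, h3, h5, h4]
  by_cases c2 : (c : ℕ) = a + 2
  · rw [show c = ⟨a + 2, by omega⟩ from Fin.ext c2, h5, h4, h2, h6]
  · simp only [sw_of_ne a (by omega : a + 1 < n) c c0 c1, sw_of_ne (a + 1) h c c1 c2]

lemma sw_comm (a b : ℕ) (ha : a + 1 < n) (hb : b + 1 < n) (hab : a + 1 < b) :
    YH.sw n a ha * YH.sw n b hb = YH.sw n b hb * YH.sw n a ha := by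
  refine (Equiv.Perm.Disjoint.commute fun c => ?_).eq
  by_cases hc : (c : ℕ) = a ∨ (c : ℕ) = a + 1
  · exact Or.inr (sw_of_ne b hb c (by omega) (by omega))
  · exact Or.inl (sw_of_ne a ha c (by omega) (by omega))

/-- A statistic on permutations that drops whenever a descent is sorted. -/
def sortDefect (p : Equiv.Perm (Fin n)) : ℕ := ∑ k : Fin n, (k : ℕ) * (n - p k)

lemma sortDefect_mul_sw_lt (p : Equiv.Perm (Fin n)) (a : ℕ) (h : a + 1 < n)
    (hd : p ⟨a + 1, h⟩ < p ⟨a, by omega⟩) : sortDefect (p * YH.sw n a h) < sortDefect p := by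
  have e1 : sortDefect (p * YH.sw n a h) = ∑ k : Fin n, (YH.sw n a h k : ℕ) * (n - p k) := by
    unfold sortDefect
    refine Fintype.sum_equiv (YH.sw n a h) _ _ fun k => ?_
    rw [Equiv.Perm.mul_apply, ← Equiv.Perm.mul_apply (YH.sw n a h), sw_mul_self]
    rfl
  have hd' : (p ⟨a + 1, h⟩ : ℕ) < p ⟨a, by omega⟩ := hd
  have e2 : (sortDefect p : ℤ) - sortDefect (p * YH.sw n a h)
      = ∑ k : Fin n, ((k : ℤ) - (YH.sw n a h k : ℕ)) * ((n - p k : ℕ) : ℤ) := by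
    rw [e1]
    simp only [sortDefect, Nat.cast_sum, Nat.cast_mul, sub_mul, Finset.sum_sub_distrib]
  rw [Fintype.sum_eq_add (⟨a, by omega⟩ : Fin n) ⟨a + 1, h⟩ (by simp)] at e2
  · rw [sw_left, sw_right] at e2
    push_cast at e2
    have := (p ⟨a, by omega⟩).2
    rw [Nat.cast_sub this.le, Nat.cast_sub (p ⟨a + 1, h⟩).2.le] at e2
    zify at hd' ⊢
    linarith
  · rintro k ⟨h1, h2⟩
    rw [sw_of_ne a h k (fun e => h1 (Fin.ext e)) (fun e => h2 (Fin.ext e))]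
    simp

lemma eq_one_of_no_descent (p : Equiv.Perm (Fin n))
    (hp : ∀ (a : ℕ) (h : a + 1 < n), ¬ p ⟨a + 1, h⟩ < p ⟨a, by omega⟩) : p = 1 := by
  have hmono : StrictMono p := by
    cases n with
    | zero => exact fun x => x.elim0
    | succ m =>
      rw [Fin.strictMono_iff_lt_succ]
      intro i
      refine lt_of_le_of_ne (not_lt.1 (hp i (by omega))) fun e => ?_
      have := p.injective e
      simp [Fin.ext_iff] at this
  have := Subsingleton.elim (hmono.orderIsoOfSurjective p p.surjective) (OrderIso.refl (Fin n))
  ext x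
  exact congrArg Fin.val (DFunLike.congr_fun this x)

theorem perm_induction {P : Equiv.Perm (Fin n) → Prop} (one : P 1)
    (step : ∀ (p : Equiv.Perm (Fin n)) (a : ℕ) (h : a + 1 < n),
      p ⟨a, by omega⟩ < p ⟨a + 1, h⟩ → P p → P (p * YH.sw n a h)) (p : Equiv.Perm (Fin n)) : P p := by
  induction hm : sortDefect p using Nat.strong_induction_on generalizing p with
  | _ m ih =>
    by_cases hd : ∃ (a : ℕ) (h : a + 1 < n), p ⟨a + 1, h⟩ < p ⟨a, by omega⟩
    · obtain ⟨a, h, hd⟩ := hd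
      have := step (p * YH.sw n a h) a h
        (by simpa only [Equiv.Perm.mul_apply, sw_left, sw_right] using hd)
        (ih _ (hm ▸ sortDefect_mul_sw_lt p a h hd) _ rfl)
      rwa [mul_sw_mul_sw] at this
    · push Not at hd
      rwa [eq_one_of_no_descent p fun a h => not_lt.2 (hd a h)]

section Lift

variable {R : Type*} [Ring R]

/-- The product of the `g a` along a sorting word of `p`: the element `g_w` with `w = p⁻¹`. -/
def braidLift (g : ∀ a : ℕ, a + 1 < n → R) (p : Equiv.Perm (Fin n)) : R :=
  if hd : ∃ (a : ℕ) (h : a + 1 < n), p ⟨a + 1, h⟩ < p ⟨a, by omega⟩ then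
    g hd.choose hd.choose_spec.choose *
      braidLift g (p * YH.sw n hd.choose hd.choose_spec.choose)
  else 1
termination_by sortDefect p
decreasing_by exact sortDefect_mul_sw_lt p _ _ hd.choose_spec.choose_spec

lemma braidLift_one (g : ∀ a : ℕ, a + 1 < n → R) : braidLift g 1 = 1 := by
  rw [braidLift, dif_neg]
  rintro ⟨a, h, hlt⟩
  simp [Fin.lt_def] at hlt

/-- The braid relations and the far commutation relations. -/
structure BraidRel (g : ∀ a : ℕ, a + 1 < n → R) : Prop where
  braid : ∀ (a : ℕ) (h : a + 2 < n),
    g a (by omega) * g (a + 1) h * g a (by omega) = g (a + 1) h * g a (by omega) * g (a + 1) h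
  far : ∀ (a b : ℕ) (ha : a + 1 < n) (hb : b + 1 < n), a + 1 < b → g a ha * g b hb = g b hb * g a ha

lemma braidLift_of_descent {g : ∀ a : ℕ, a + 1 < n → R} (hg : BraidRel g)
    (p : Equiv.Perm (Fin n)) (a : ℕ) (h : a + 1 < n) (hd : p ⟨a + 1, h⟩ < p ⟨a, by omega⟩) :
    braidLift g p = g a h * braidLift g (p * YH.sw n a h) := by
  induction hm : sortDefect p using Nat.strong_induction_on generalizing p a with
  | _ m ih =>
    subst hm
    have ih' : ∀ (b : ℕ) (hb : b + 1 < n), p ⟨b + 1, hb⟩ < p ⟨b, by omega⟩ →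
        ∀ (c : ℕ) (hc : c + 1 < n), (p * YH.sw n b hb) ⟨c + 1, hc⟩ < (p * YH.sw n b hb) ⟨c, by omega⟩ →
        braidLift g (p * YH.sw n b hb)
          = g c hc * braidLift g (p * YH.sw n b hb * YH.sw n c hc) := fun b hb hpb c hc hpc =>
      ih _ (sortDefect_mul_sw_lt p b hb hpb) _ c hc hpc rfl
    have key : ∀ (b c : ℕ) (hb : b + 1 < n) (hc : c + 1 < n), b < c →
        p ⟨b + 1, hb⟩ < p ⟨b, by omega⟩ → p ⟨c + 1, hc⟩ < p ⟨c, by omega⟩ →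
        g b hb * braidLift g (p * YH.sw n b hb) = g c hc * braidLift g (p * YH.sw n c hc) := by
      intro b c hb hc hbc hpb hpc
      rcases Nat.lt_or_ge (b + 1) c with hlt | hge
      · rw [ih' b hb hpb c hc, ih' c hc hpc b hb, mul_assoc p, mul_assoc p, ← sw_comm b c hb hc hlt,
          ← mul_assoc, ← mul_assoc (g c hc), hg.far b c hb hc hlt]
        · rw [Equiv.Perm.mul_apply, Equiv.Perm.mul_apply,
            sw_of_ne c hc _ (by simp; omega) (by simp; omega),
            sw_of_ne c hc _ (by simp; omega) (by simp; omega)]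
          exact hpb
        · rw [Equiv.Perm.mul_apply, Equiv.Perm.mul_apply,
            sw_of_ne b hb _ (by simp; omega) (by simp; omega),
            sw_of_ne b hb _ (by simp; omega) (by simp; omega)]
          exact hpc
      · obtain rfl : c = b + 1 := by omega
        have s1 := sw_left b hb
        have s2 := sw_right b hb
        have s3 := sw_left (b + 1) hc
        have s4 := sw_right (b + 1) hc
        have s5 := sw_of_ne b hb ⟨b + 2, hc⟩ (by simp) (by simp)
        have s6 := sw_of_ne (b + 1) hc ⟨b, by omega⟩ (by simp) (by simp; omega)
        have hb1 : (p * YH.sw n b hb) ⟨b + 1 + 1, hc⟩ < (p * YH.sw n b hb) ⟨b + 1, hb⟩ := by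
          simp only [Equiv.Perm.mul_apply, s2, s5]
          exact hpc.trans hpb
        have hc1 : (p * YH.sw n (b + 1) hc) ⟨b + 1, hb⟩ < (p * YH.sw n (b + 1) hc) ⟨b, by omega⟩ := by
          simp only [Equiv.Perm.mul_apply, s3, s6]
          exact hpc.trans hpb
        rw [ih' b hb hpb (b + 1) hc hb1, ih' (b + 1) hc hpc b hb hc1,
          ih _ ((sortDefect_mul_sw_lt _ _ hc hb1).trans (sortDefect_mul_sw_lt p b hb hpb)) _ b hb
            (by simpa only [Equiv.Perm.mul_apply, s1, s2, s3, s4, s5, s6] using hpc) rfl,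
          ih _ ((sortDefect_mul_sw_lt _ _ hb hc1).trans (sortDefect_mul_sw_lt p (b + 1) hc hpc)) _
            (b + 1) hc
            (by simpa only [Equiv.Perm.mul_apply, s1, s2, s3, s4, s5, s6] using hpb) rfl]
        have hp : p * YH.sw n b hb * YH.sw n (b + 1) hc * YH.sw n b hb
            = p * YH.sw n (b + 1) hc * YH.sw n b hb * YH.sw n (b + 1) hc := by
          simp only [mul_assoc p]
          rw [sw_braid b hc]
        rw [hp]
        simp only [← mul_assoc]
        rw [hg.braid b hc]
    have hex : ∃ (a : ℕ) (h : a + 1 < n), p ⟨a + 1, h⟩ < p ⟨a, by omega⟩ := ⟨a, h, hd⟩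
    rw [braidLift, dif_pos hex]
    have key' : ∀ (c : ℕ) (hc : c + 1 < n), p ⟨c + 1, hc⟩ < p ⟨c, by omega⟩ →
        g c hc * braidLift g (p * YH.sw n c hc) = g a h * braidLift g (p * YH.sw n a h) := by
      intro c hc hpc
      rcases lt_trichotomy c a with hca | rfl | hca
      · exact key c a _ h hca hpc hd
      · rfl
      · exact (key a c h _ hca hd hpc).symm
    exact key' _ _ hex.choose_spec.choose_spec

lemma braidLift_mul_sw {g : ∀ a : ℕ, a + 1 < n → R} (hg : BraidRel g)
    (p : Equiv.Perm (Fin n)) (a : ℕ) (h : a + 1 < n) (hd : p ⟨a, by omega⟩ < p ⟨a + 1, h⟩) :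
    braidLift g (p * YH.sw n a h) = g a h * braidLift g p := by
  rw [braidLift_of_descent hg _ a h, mul_sw_mul_sw]
  simpa only [Equiv.Perm.mul_apply, sw_left, sw_right] using hd

lemma map_braidLift {R' F : Type*} [Ring R'] [FunLike F R R'] [RingHomClass F R R']
    {g : ∀ a : ℕ, a + 1 < n → R} (hg : BraidRel g) {g' : ∀ a : ℕ, a + 1 < n → R'}
    (hg' : BraidRel g') (φ : F) (hφ : ∀ a h, φ (g a h) = g' a h) (p : Equiv.Perm (Fin n)) :
    φ (braidLift g p) = braidLift g' p := by
  induction p using perm_induction with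
  | one => simp only [braidLift_one, map_one]
  | step p a h hlt ih => rw [braidLift_mul_sw hg p a h hlt, braidLift_mul_sw hg' p a h hlt,
      map_mul, ih, hφ]

end Lift

/-- A set with an action of `S_n` whose points induce relations on `Fin n`. -/
structure PermSet (n : ℕ) (X : Type) where
  act : Equiv.Perm (Fin n) → X → X
  act_one : ∀ x, act 1 x = x
  act_mul : ∀ σ τ x, act (σ * τ) x = act σ (act τ x)
  rel : X → Fin n → Fin n → Prop

lemma PermSet.act_sw_act_sw {X : Type} (P : PermSet n X) (a : ℕ) (h : a + 1 < n) (x : X) :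
    P.act (YH.sw n a h) (P.act (YH.sw n a h) x) = x := by
  rw [← P.act_mul, sw_mul_self, P.act_one]

section System

variable {𝕜 : Type} [Field 𝕜] {X : Type} [Fintype X] {R : Type*} [Ring R] [Algebra 𝕜 R]

/-- Elements `g a` and `e x` of an algebra satisfying the relations of the algebra of type
`E′_n(q)` with idempotents indexed by `X`. -/
structure BTSystem (P : PermSet n X) (q : 𝕜) (g : ∀ a : ℕ, a + 1 < n → R) (e : X → R) : Prop
    extends BraidRel g where
  unit : ∑ x, e x = 1
  orth : ∀ x y, e x * e y = if x = y then e x else 0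
  gmove : ∀ a h x, g a h * e x = e (P.act (YH.sw n a h) x) * g a h
  sqn : ∀ (a : ℕ) (h : a + 1 < n) (x : X), ¬ P.rel x ⟨a, by omega⟩ ⟨a + 1, h⟩ →
    g a h ^ 2 * e x = q • e x
  sqy : ∀ (a : ℕ) (h : a + 1 < n) (x : X), P.rel x ⟨a, by omega⟩ ⟨a + 1, h⟩ →
    g a h ^ 2 * e x = (algebraMap 𝕜 R q + (q - 1) • g a h) * e x

namespace BTSystem

variable {P : PermSet n X} {q : 𝕜} {g : ∀ a : ℕ, a + 1 < n → R} {e : X → R}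

lemma pushforward (S : BTSystem P q g e) {X' : Type} [Fintype X'] (P' : PermSet n X')
    (f : X → X') (hact : ∀ σ x, f (P.act σ x) = P'.act σ (f x))
    (hrel : ∀ x a b, P'.rel (f x) a b ↔ P.rel x a b) :
    BTSystem P' q g (fun y => ∑ x ∈ Finset.univ.filter (fun x => f x = y), e x) where
  toBraidRel := S.toBraidRel
  unit := by
    rw [← S.unit]
    exact Finset.sum_fiberwise Finset.univ f e
  orth x y := by
    simp only [Finset.sum_mul_sum, S.orth, Finset.sum_ite_eq, Finset.mem_filter,
      Finset.mem_univ, true_and]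
    split_ifs with hxy
    · subst hxy
      exact Finset.sum_congr rfl fun z hz => if_pos (Finset.mem_filter.1 hz).2
    · exact Finset.sum_eq_zero fun z hz =>
        if_neg fun e' => hxy ((Finset.mem_filter.1 hz).2.symm.trans e')
  gmove a h y := by
    rw [Finset.mul_sum, Finset.sum_mul]
    refine Finset.sum_nbij' (P.act (YH.sw n a h)) (P.act (YH.sw n a h)) ?_ ?_ ?_ ?_ ?_
    · intro x hx
      simp only [Finset.mem_filter, Finset.mem_univ, true_and] at hx ⊢
      rw [hact, hx]
    · intro x hx
      simp only [Finset.mem_filter, Finset.mem_univ, true_and] at hx ⊢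
      rw [hact, hx, P'.act_sw_act_sw]
    · exact fun x _ => P.act_sw_act_sw a h x
    · exact fun x _ => P.act_sw_act_sw a h x
    · exact fun x _ => S.gmove a h x
  sqn a h y hy := by
    rw [Finset.mul_sum, Finset.smul_sum]
    refine Finset.sum_congr rfl fun x hx => S.sqn a h x ?_
    rwa [← hrel, (Finset.mem_filter.1 hx).2]
  sqy a h y hy := by
    rw [Finset.mul_sum, Finset.mul_sum]
    refine Finset.sum_congr rfl fun x hx => S.sqy a h x ?_
    rwa [← hrel, (Finset.mem_filter.1 hx).2]

lemma braidLift_mul (S : BTSystem P q g e) (p : Equiv.Perm (Fin n)) (x : X) :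
    braidLift g p * e x = e (P.act p⁻¹ x) * braidLift g p := by
  induction p using perm_induction with
  | one => simp only [braidLift_one, inv_one, P.act_one, one_mul, mul_one]
  | step p a h hlt ih =>
    rw [braidLift_mul_sw S.toBraidRel p a h hlt, mul_assoc, ih, ← mul_assoc, S.gmove, mul_assoc,
      mul_inv_rev, P.act_mul, sw_inv]

lemma span_eq_top (S : BTSystem P q g e)
    (hgen : ∀ B : Subalgebra 𝕜 R, (∀ a h, g a h ∈ B) → (∀ x, e x ∈ B) → B = ⊤) :
    Submodule.span 𝕜 (Set.range fun i : Equiv.Perm (Fin n) × X => braidLift g i.1 * e i.2) = ⊤ := by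
  set N := Submodule.span 𝕜
    (Set.range fun i : Equiv.Perm (Fin n) × X => braidLift g i.1 * e i.2) with hN
  have hmem : ∀ p x, braidLift g p * e x ∈ N := fun p x =>
    Submodule.subset_span ⟨(p, x), rfl⟩
  have key : ∀ r : R, (∀ p x, r * (braidLift g p * e x) ∈ N) → ∀ y ∈ N, r * y ∈ N := by
    intro r hr y hy
    induction hy using Submodule.span_induction with
    | mem y hy => obtain ⟨i, rfl⟩ := hy; exact hr _ _
    | zero => rw [mul_zero]; exact N.zero_mem
    | add y z _ _ h1 h2 => rw [mul_add]; exact N.add_mem h1 h2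
    | smul c y _ h1 => rw [mul_smul_comm]; exact N.smul_mem c h1
  let B : Subalgebra 𝕜 R :=
    { carrier := {r | ∀ y ∈ N, r * y ∈ N}
      mul_mem' := fun {r s} hr hs y hy => by rw [mul_assoc]; exact hr _ (hs _ hy)
      add_mem' := fun {r s} hr hs y hy => by rw [add_mul]; exact N.add_mem (hr _ hy) (hs _ hy)
      algebraMap_mem' := fun c y hy => by
        rw [← Algebra.smul_def]; exact N.smul_mem c hy }
  have hB : B = ⊤ := by
    refine hgen B (fun a h => key _ fun p x => ?_) (fun x => key _ fun p y => ?_)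
    · rcases lt_trichotomy (p ⟨a, by omega⟩) (p ⟨a + 1, h⟩) with hlt | heq | hgt
      · rw [← mul_assoc, ← braidLift_mul_sw S.toBraidRel p a h hlt]
        exact hmem _ _
      · have := p.injective heq
        simp at this
      · rw [braidLift_of_descent S.toBraidRel p a h hgt]
        have e1 : g a h * (g a h * braidLift g (p * YH.sw n a h) * e x)
            = g a h ^ 2 * e (P.act (p * YH.sw n a h)⁻¹ x) * braidLift g (p * YH.sw n a h) := by
          rw [mul_assoc (g a h), S.braidLift_mul, sq]
          simp only [mul_assoc]
        rw [e1]
        by_cases hr : P.rel (P.act (p * YH.sw n a h)⁻¹ x) ⟨a, by omega⟩ ⟨a + 1, h⟩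
        · rw [S.sqy a h _ hr, mul_assoc, ← S.braidLift_mul, add_mul, ← Algebra.smul_def,
            smul_mul_assoc, ← mul_assoc (g a h), ← braidLift_of_descent S.toBraidRel p a h hgt]
          exact N.add_mem (N.smul_mem _ (hmem _ _)) (N.smul_mem _ (hmem _ _))
        · rw [S.sqn a h _ hr, smul_mul_assoc, ← S.braidLift_mul]
          exact N.smul_mem _ (hmem _ _)
    · rw [S.braidLift_mul, ← mul_assoc, S.orth]
      split_ifs with hxy
      · rw [hxy, ← S.braidLift_mul]
        exact hmem _ _
      · rw [zero_mul]
        exact N.zero_mem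
  have h1 : (1 : R) ∈ N := by
    rw [← S.unit]
    refine N.sum_mem fun x _ => ?_
    simpa only [braidLift_one, one_mul] using hmem 1 x
  refine eq_top_iff.2 fun r _ => ?_
  have hr : r ∈ B := hB ▸ Algebra.mem_top
  simpa only [mul_one] using hr 1 h1

/-- A homomorphism is injective as soon as it separates the spanning set `g_w e(x)` through
linear maps `ψ x`, each of which sees only the elements `g_w e(x)` with that `x`. -/
lemma injective_of_separating (S : BTSystem P q g e)
    (hgen : ∀ B : Subalgebra 𝕜 R, (∀ a h, g a h ∈ B) → (∀ x, e x ∈ B) → B = ⊤)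
    (ψ : X → R →ₗ[𝕜] (Equiv.Perm (Fin n) →₀ 𝕜))
    (hψ : ∀ x p y, ψ x (braidLift g p * e y) = if x = y then Finsupp.single p 1 else 0)
    (r : R) (hr : ∀ x, ψ x r = 0) : r = 0 := by
  have hmem : r ∈ Submodule.span 𝕜
      (Set.range fun i : Equiv.Perm (Fin n) × X => braidLift g i.1 * e i.2) := by
    rw [S.span_eq_top hgen]
    trivial
  obtain ⟨c, rfl⟩ := (Submodule.mem_span_range_iff_exists_fun 𝕜).1 hmem
  refine Finset.sum_eq_zero fun i _ => ?_
  have h0 : ψ i.2 (∑ i, c i • (braidLift g i.1 * e i.2)) i.1 = c i := by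
    rw [map_sum, Finsupp.finsetSum_apply, Finset.sum_eq_single i]
    · simp [hψ]
    · intro j _ hji
      rw [map_smul, hψ]
      split_ifs with h2
      · have : j.1 ≠ i.1 := fun h1 => hji (Prod.ext h1 h2.symm)
        simp [this]
      · simp
    · simp
  rw [hr] at h0
  rw [← h0]
  simp

end BTSystem

end System

section Character

variable {d : ℕ}

lemma pow_val_natCast {M : Type*} [Monoid M] {u : M} (hu : u ^ d = 1) (k : ℕ) :
    u ^ ((k : ZMod d).val) = u ^ k := by
  rw [ZMod.val_natCast, ← pow_eq_pow_mod k hu]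

lemma pow_val_add [NeZero d] {M : Type*} [Monoid M] {u : M} (hu : u ^ d = 1) (x y : ZMod d) :
    u ^ (x + y).val = u ^ x.val * u ^ y.val := by
  rw [ZMod.val_add, ← pow_eq_pow_mod _ hu, pow_add]

lemma pow_val_mul_natCast [NeZero d] {M : Type*} [Monoid M] {u : M} (hu : u ^ d = 1) (x : ZMod d) (r : ℕ) :
    u ^ (x * (r : ZMod d)).val = (u ^ x.val) ^ r := by
  rw [← pow_mul, ← pow_val_natCast hu (x.val * r), Nat.cast_mul, ZMod.natCast_zmod_val]

lemma sum_range_eq_sum_zmod [NeZero d] {M : Type*} [AddCommMonoid M] (f : ℕ → M) :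
    ∑ r ∈ Finset.range d, f r = ∑ r : ZMod d, f r.val := by
  refine Finset.sum_bij' (fun r _ => (r : ZMod d)) (fun r _ => r.val) ?_ ?_ ?_ ?_ ?_
  · simp
  · exact fun r _ => Finset.mem_range.2 r.val_lt
  · exact fun r hr => ZMod.val_cast_of_lt (Finset.mem_range.1 hr)
  · exact fun r _ => ZMod.natCast_zmod_val r
  · exact fun r hr => by rw [ZMod.val_cast_of_lt (Finset.mem_range.1 hr)]

variable {𝕜 : Type} [Field 𝕜] {ξ : 𝕜}

lemma sum_pow_val_mul [NeZero d] (hξ : IsPrimitiveRoot ξ d) (s : ZMod d) :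
    ∑ c : ZMod d, ξ ^ (s * c).val = if s = 0 then (d : 𝕜) else 0 := by
  split_ifs with hs
  · simp [hs, ZMod.card]
  · have h1 : ξ ^ s.val * ∑ c : ZMod d, ξ ^ (s * c).val = ∑ c : ZMod d, ξ ^ (s * c).val := by
      rw [Finset.mul_sum]
      refine Fintype.sum_equiv (Equiv.addRight 1) _ _ fun c => ?_
      rw [← pow_val_add hξ.pow_eq_one, Equiv.coe_addRight, mul_add, mul_one, add_comm]
    have h2 : ξ ^ s.val ≠ 1 :=
      hξ.pow_ne_one_of_pos_of_lt (by simpa [ZMod.val_eq_zero] using hs) s.val_lt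
    have h3 : (ξ ^ s.val - 1) * ∑ c : ZMod d, ξ ^ (s * c).val = 0 := by
      rw [sub_mul, h1, one_mul, sub_self]
    exact (mul_eq_zero.1 h3).resolve_left (sub_ne_zero.2 h2)

variable {A : Type*} [Ring A] [Algebra 𝕜 A]

/-- The projection `(1/d) Σ_r ξ^{-c r} u^r` onto the `ξ^c`-eigenspace of `u`. -/
def eigenProj (ξ : 𝕜) (u : A) (c : ZMod d) : A :=
  (d : 𝕜)⁻¹ • ∑ r ∈ Finset.range d, ξ ^ (((-c) * (r : ZMod d)).val) • u ^ r

lemma map_eigenProj {B : Type*} [Ring B] [Algebra 𝕜 B] (φ : A →ₐ[𝕜] B) (u : A) (c : ZMod d) :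
    φ (eigenProj ξ u c) = eigenProj ξ (φ u) c := by
  simp only [eigenProj, map_smul, map_sum, map_pow]

lemma mul_eigenProj [NeZero d] (hξ : ξ ^ d = 1) {u : A} (hu : u ^ d = 1) (c : ZMod d) :
    u * eigenProj ξ u c = ξ ^ c.val • eigenProj ξ u c := by
  have hu1 : u = u ^ (1 : ZMod d).val := by
    simpa using (pow_val_natCast hu 1).symm
  simp only [eigenProj, sum_range_eq_sum_zmod, ZMod.natCast_zmod_val]
  rw [mul_smul_comm, smul_comm (ξ ^ c.val), Finset.mul_sum, Finset.smul_sum (r := ξ ^ c.val)]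
  refine congrArg _ (Fintype.sum_equiv (Equiv.addRight (1 : ZMod d)) _ _ fun r => ?_)
  simp only [Equiv.coe_addRight]
  rw [mul_smul_comm, smul_smul, ← pow_val_add hξ, add_comm r 1, pow_val_add hu, ← hu1]
  congr 3
  ring

lemma sum_eigenProj [NeZero d] (hξ : IsPrimitiveRoot ξ d) (hd : (d : 𝕜) ≠ 0) (u : A) :
    ∑ c : ZMod d, eigenProj ξ u c = 1 := by
  simp only [eigenProj, sum_range_eq_sum_zmod, ZMod.natCast_zmod_val]
  rw [← Finset.smul_sum, Finset.sum_comm]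
  have h : ∀ r : ZMod d, ∑ c : ZMod d, ξ ^ ((-c) * r).val • u ^ r.val
      = if r = 0 then (d : 𝕜) • (1 : A) else 0 := by
    intro r
    have e : ∀ c : ZMod d, (-c) * r = (-r) * c := fun c => by ring
    simp only [e]
    rw [← Finset.sum_smul, sum_pow_val_mul hξ]
    by_cases hr : r = 0
    · simp [hr]
    · simp [hr]
  simp only [h, Finset.sum_ite_eq', Finset.mem_univ, if_true]
  rw [smul_smul, inv_mul_cancel₀ hd, one_smul]

variable {M : Type*} [AddCommGroup M] [Module 𝕜 M] [Module A M] [IsScalarTower 𝕜 A M]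

lemma pow_smul_of_eigen {u : A} {m : M} {c : 𝕜} (hm : u • m = c • m) (r : ℕ) :
    u ^ r • m = c ^ r • m := by
  induction r with
  | zero => simp
  | succ r ih =>
    have : u • (c ^ r • m) = c ^ r • (u • m) := by
      rw [← smul_one_smul A (c ^ r) m, ← smul_one_smul A (c ^ r) (u • m), smul_smul, smul_smul,
        mul_smul_comm, smul_mul_assoc, mul_one, one_mul]
    rw [pow_succ', mul_smul, ih, this, hm, smul_smul, pow_succ]

lemma eigenProj_smul [NeZero d] (hξ : IsPrimitiveRoot ξ d) (hd : (d : 𝕜) ≠ 0) {u : A} {m : M} {c : ZMod d}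
    (hm : u • m = ξ ^ c.val • m) (c' : ZMod d) :
    eigenProj ξ u c' • m = if c' = c then m else 0 := by
  have h : ∀ r ∈ Finset.range d, ξ ^ ((-c') * (r : ZMod d)).val • u ^ r • m
      = ξ ^ ((c - c') * (r : ZMod d)).val • m := fun r _ => by
    rw [pow_smul_of_eigen hm, ← pow_val_mul_natCast hξ.pow_eq_one, smul_smul,
      ← pow_val_add hξ.pow_eq_one]
    congr 3
    ring
  rw [eigenProj, smul_assoc, Finset.sum_smul]
  simp only [smul_assoc]
  rw [Finset.sum_congr rfl h, ← Finset.sum_smul]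
  simp only [sum_range_eq_sum_zmod, ZMod.natCast_zmod_val]
  rw [sum_pow_val_mul hξ, smul_smul]
  by_cases hc : c' = c
  · simp [hc, hd]
  · simp [hc, sub_eq_zero, Ne.symm hc]

lemma eigenAgree_smul [NeZero d] (hξ : IsPrimitiveRoot ξ d) (hd : (d : 𝕜) ≠ 0) {u w : A} {m : M}
    {c c' : ZMod d} (hw : w ^ d = 1) (hm : u • m = ξ ^ c.val • m) (hm' : w • m = ξ ^ c'.val • m) :
    ((d : 𝕜)⁻¹ • ∑ r ∈ Finset.range d, u ^ r * w ^ ((d - r) % d)) • m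
      = if c = c' then m else 0 := by
  have h : ∀ r ∈ Finset.range d, (u ^ r * w ^ ((d - r) % d)) • m
      = ξ ^ ((c - c') * (r : ZMod d)).val • m := fun r hr => by
    have hr' : ((d - r : ℕ) : ZMod d) = - r := by
      rw [Nat.cast_sub (Finset.mem_range.1 hr).le]
      simp
    rw [← pow_eq_pow_mod _ hw, mul_smul, pow_smul_of_eigen hm',
      ← smul_one_smul A (_ : 𝕜) m, ← mul_smul, mul_smul_comm, mul_one, smul_assoc,
      pow_smul_of_eigen hm, smul_smul, ← pow_val_mul_natCast hξ.pow_eq_one,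
      ← pow_val_mul_natCast hξ.pow_eq_one, ← pow_val_add hξ.pow_eq_one, hr']
    congr 3
    ring
  rw [smul_assoc, Finset.sum_smul, Finset.sum_congr rfl h, ← Finset.sum_smul]
  simp only [sum_range_eq_sum_zmod, ZMod.natCast_zmod_val]
  rw [sum_pow_val_mul hξ, smul_smul]
  by_cases hc : c = c'
  · simp [hc, hd]
  · simp [hc, sub_eq_zero]

lemma prod_eigenProj_smul [NeZero d] (hξ : IsPrimitiveRoot ξ d) (hd : (d : 𝕜) ≠ 0) {u : Fin n → A} {m : M}
    {j : Fin n → ZMod d} (hm : ∀ a, u a • m = ξ ^ (j a).val • m) (i : Fin n → ZMod d) :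
    ((List.finRange n).map fun a => eigenProj ξ (u a) (i a)).prod • m = if i = j then m else 0 := by
  have key : ∀ l : List (Fin n), (l.map fun a => eigenProj ξ (u a) (i a)).prod • m
      = if ∀ a ∈ l, i a = j a then m else 0 := by
    intro l
    induction l with
    | nil => simp
    | cons a l ih =>
      rw [List.map_cons, List.prod_cons, mul_smul, ih]
      simp only [List.forall_mem_cons]
      by_cases hl : ∀ a ∈ l, i a = j a
      · rw [if_pos hl, eigenProj_smul hξ hd (hm a)]
        exact if_congr (and_iff_left hl).symm rfl rfl
      · rw [if_neg hl, smul_zero, if_neg fun h => hl h.2]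
  rw [key]
  simp only [List.mem_finRange, true_implies, funext_iff]

end Character

section Colorings

variable (d : ℕ) (n) in
/-- The `S_n`-set of colorings `j ∈ (ℤ/dℤ)^n`. -/
def colorSet : PermSet n (Fin n → ZMod d) where
  act σ j x := j (σ.symm x)
  act_one _ := rfl
  act_mul _ _ _ := rfl
  rel j a b := j a = j b

variable {𝕜 : Type} [Field 𝕜] {q ξ : 𝕜} {d : ℕ}

lemma ej_eq_prod (j : Fin n → ZMod d) :
    YH.ej 𝕜 d n q ξ j
      = ((List.finRange n).map fun a => eigenProj ξ (YH.t 𝕜 d n q a) (j a)).prod := rfl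

lemma Y_mk_rel {x y : YH.F 𝕜 n} (h : YH.Rel 𝕜 d n q x y) : YH.π 𝕜 d n q x = YH.π 𝕜 d n q y :=
  RingQuot.mkAlgHom_rel 𝕜 h

lemma t_pow (a : Fin n) : YH.t 𝕜 d n q a ^ d = 1 := by
  simpa only [YH.t, YH.g, YH.eA, map_pow, map_one] using Y_mk_rel (YH.Rel.torder (q := q) a)

lemma t_comm (a b : Fin n) :
    YH.t 𝕜 d n q a * YH.t 𝕜 d n q b = YH.t 𝕜 d n q b * YH.t 𝕜 d n q a := by
  simpa only [YH.t, YH.g, YH.eA, map_mul] using Y_mk_rel (YH.Rel.tcomm (d := d) (q := q) a b)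

lemma t_mul_g (a : Fin n) (b : ℕ) (hb : b + 1 < n) :
    YH.t 𝕜 d n q a * YH.g 𝕜 d n q b hb
      = YH.g 𝕜 d n q b hb * YH.t 𝕜 d n q (YH.sw n b hb a) := by
  simpa only [YH.t, YH.g, YH.eA, map_mul] using Y_mk_rel (YH.Rel.tg (d := d) (q := q) a b hb)

lemma g_sq (a : ℕ) (h : a + 1 < n) :
    YH.g 𝕜 d n q a h ^ 2 = algebraMap 𝕜 _ q
      + (q - 1) • (YH.eA 𝕜 d n q a h * YH.g 𝕜 d n q a h) := by
  simpa only [YH.t, YH.g, YH.eA, map_pow, map_mul, map_add, map_smul, AlgHom.commutes] using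
    Y_mk_rel (YH.Rel.quad (d := d) (q := q) a h)

lemma braidRel_Y : BraidRel (YH.g 𝕜 d n q) where
  braid a h := by
    simpa only [YH.t, YH.g, YH.eA, map_mul] using Y_mk_rel (YH.Rel.braid (d := d) (q := q) a h)
  far a b ha hb hab := by
    simpa only [YH.t, YH.g, YH.eA, map_mul] using Y_mk_rel (YH.Rel.gcomm (d := d) (q := q) a b ha hb hab)

lemma eA_eq (a : ℕ) (h : a + 1 < n) :
    YH.eA 𝕜 d n q a h = (d : 𝕜)⁻¹ • ∑ r ∈ Finset.range d,
      YH.t 𝕜 d n q ⟨a, by omega⟩ ^ r * YH.t 𝕜 d n q ⟨a + 1, h⟩ ^ ((d - r) % d) := by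
  simp only [YH.eA, YH.Efree, map_smul, map_sum, map_mul, map_pow]
  rfl

variable (n 𝕜 q d) in
/-- The elements `t a` come from a commutative algebra. -/
lemma exists_commutative_lift : ∃ (C : Type) (_ : CommRing C) (_ : Algebra 𝕜 C)
    (φ : C →ₐ[𝕜] YH.Y 𝕜 d n q) (τ : Fin n → C),
    (∀ a, φ (τ a) = YH.t 𝕜 d n q a) ∧ ∀ a, τ a ^ d = 1 := by
  let S := Algebra.adjoin 𝕜 (Set.range (YH.t 𝕜 d n q))
  have hS : IsMulCommutative S := Algebra.isMulCommutative_adjoin 𝕜 (by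
    rintro _ ⟨a, rfl⟩ _ ⟨b, rfl⟩
    exact t_comm a b)
  let _ : CommRing S := { S.toRing with mul_comm := hS.is_comm.comm }
  refine ⟨S, ‹CommRing S›, S.algebra, S.val,
    fun a => ⟨YH.t 𝕜 d n q a, Algebra.subset_adjoin ⟨a, rfl⟩⟩, fun a => rfl, fun a => ?_⟩
  exact Subtype.ext (t_pow a)

lemma map_prod_eigenProj {C : Type} [CommRing C] [Algebra 𝕜 C] (φ : C →ₐ[𝕜] YH.Y 𝕜 d n q)
    {τ : Fin n → C} (hφ : ∀ a, φ (τ a) = YH.t 𝕜 d n q a) (j : Fin n → ZMod d) :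
    φ (∏ a, eigenProj ξ (τ a) (j a)) = YH.ej 𝕜 d n q ξ j := by
  rw [ej_eq_prod, Fin.prod_univ_def, map_list_prod, List.map_map]
  congr 2
  ext a
  rw [Function.comp_apply, map_eigenProj, hφ]

lemma t_mul_ej [NeZero d] (hξ : ξ ^ d = 1) (a : Fin n) (j : Fin n → ZMod d) :
    YH.t 𝕜 d n q a * YH.ej 𝕜 d n q ξ j = ξ ^ (j a).val • YH.ej 𝕜 d n q ξ j := by
  obtain ⟨C, _, _, φ, τ, hφ, hτ⟩ := exists_commutative_lift n 𝕜 q d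
  rw [← map_prod_eigenProj φ hφ, ← hφ, ← map_mul, ← map_smul,
    ← Finset.mul_prod_erase Finset.univ _ (Finset.mem_univ a), ← mul_assoc,
    mul_eigenProj hξ (hτ a), smul_mul_assoc]

lemma ej_mul_ej [NeZero d] (hξ : IsPrimitiveRoot ξ d) (hd : (d : 𝕜) ≠ 0)
    (i j : Fin n → ZMod d) : YH.ej 𝕜 d n q ξ i * YH.ej 𝕜 d n q ξ j
      = if i = j then YH.ej 𝕜 d n q ξ i else 0 := by
  have := prod_eigenProj_smul hξ hd (u := YH.t 𝕜 d n q) (m := YH.ej 𝕜 d n q ξ j) (j := j)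
    (fun a => t_mul_ej hξ.pow_eq_one a j) i
  rw [← ej_eq_prod, smul_eq_mul] at this
  rw [this]
  split_ifs with h
  · rw [h]
  · rfl

lemma sum_ej [NeZero d] (hξ : IsPrimitiveRoot ξ d) (hd : (d : 𝕜) ≠ 0) :
    ∑ j, YH.ej 𝕜 d n q ξ j = 1 := by
  obtain ⟨C, _, _, φ, τ, hφ, hτ⟩ := exists_commutative_lift n 𝕜 q d
  simp only [← map_prod_eigenProj φ hφ]
  rw [← map_sum, ← Fintype.piFinset_univ, ← Finset.prod_univ_sum]
  simp only [sum_eigenProj hξ hd, Finset.prod_const_one, map_one]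

lemma g_mul_ej (b : ℕ) (hb : b + 1 < n) (j : Fin n → ZMod d) :
    YH.g 𝕜 d n q b hb * YH.ej 𝕜 d n q ξ j
      = YH.ej 𝕜 d n q ξ ((colorSet n d).act (YH.sw n b hb) j) * YH.g 𝕜 d n q b hb := by
  obtain ⟨C, _, _, φ, τ, hφ, hτ⟩ := exists_commutative_lift n 𝕜 q d
  have h1 : ∀ a, YH.g 𝕜 d n q b hb * YH.t 𝕜 d n q a
      = YH.t 𝕜 d n q (YH.sw n b hb a) * YH.g 𝕜 d n q b hb := fun a => by
    rw [t_mul_g, ← Equiv.Perm.mul_apply, sw_mul_self, Equiv.Perm.one_apply]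
  have hpow : ∀ (a : Fin n) (r : ℕ), YH.g 𝕜 d n q b hb * YH.t 𝕜 d n q a ^ r
      = YH.t 𝕜 d n q (YH.sw n b hb a) ^ r * YH.g 𝕜 d n q b hb := fun a r =>
    ((show SemiconjBy _ _ _ from h1 a).pow_right r)
  have h2 : ∀ (a : Fin n) (c : ZMod d),
      YH.g 𝕜 d n q b hb * φ (eigenProj ξ (τ a) c)
        = φ (eigenProj ξ (τ (YH.sw n b hb a)) c) * YH.g 𝕜 d n q b hb := fun a c => by
    rw [map_eigenProj, map_eigenProj, hφ, hφ, eigenProj, eigenProj, mul_smul_comm,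
      smul_mul_assoc, Finset.mul_sum, Finset.sum_mul]
    simp only [mul_smul_comm, smul_mul_assoc, hpow]
  have h3 : ∀ s : Finset (Fin n), YH.g 𝕜 d n q b hb * φ (∏ a ∈ s, eigenProj ξ (τ a) (j a))
      = φ (∏ a ∈ s, eigenProj ξ (τ (YH.sw n b hb a)) (j a)) * YH.g 𝕜 d n q b hb := by
    intro s
    induction s using Finset.induction_on with
    | empty => simp
    | insert a s ha ih =>
      rw [Finset.prod_insert ha, Finset.prod_insert ha, map_mul, map_mul, ← mul_assoc, h2,
        mul_assoc, ih, mul_assoc]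
  rw [← map_prod_eigenProj φ hφ, ← map_prod_eigenProj φ hφ, h3]
  congr 2
  exact Fintype.prod_equiv (YH.sw n b hb) _ _ fun a => by simp [colorSet]

lemma btSystem_Y [NeZero d] (hξ : IsPrimitiveRoot ξ d) (hd : (d : 𝕜) ≠ 0) :
    BTSystem (colorSet n d) q (YH.g 𝕜 d n q) (YH.ej 𝕜 d n q ξ) := by
  have hsq : ∀ (a : ℕ) (h : a + 1 < n) (j : Fin n → ZMod d),
      YH.g 𝕜 d n q a h ^ 2 * YH.ej 𝕜 d n q ξ j = q • YH.ej 𝕜 d n q ξ j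
        + (q - 1) • ((if j ⟨a, by omega⟩ = j ⟨a + 1, h⟩ then
          YH.g 𝕜 d n q a h * YH.ej 𝕜 d n q ξ j else 0)) := by
    intro a h j
    set i := (colorSet n d).act (YH.sw n a h) j with hi
    have h1 : YH.eA 𝕜 d n q a h * YH.ej 𝕜 d n q ξ i
        = if i ⟨a, by omega⟩ = i ⟨a + 1, h⟩ then YH.ej 𝕜 d n q ξ i else 0 := by
      rw [eA_eq]
      exact eigenAgree_smul (u := YH.t 𝕜 d n q ⟨a, by omega⟩) (w := YH.t 𝕜 d n q ⟨a + 1, h⟩)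
        (m := YH.ej 𝕜 d n q ξ i) hξ hd (t_pow _) (t_mul_ej hξ.pow_eq_one _ _)
        (t_mul_ej hξ.pow_eq_one _ _)
    rw [g_sq, add_mul, ← Algebra.smul_def, smul_mul_assoc, mul_assoc, g_mul_ej, ← hi, ← mul_assoc, h1]
    have h2 : (i ⟨a, by omega⟩ = i ⟨a + 1, h⟩) ↔ j ⟨a, by omega⟩ = j ⟨a + 1, h⟩ := by
      simp only [hi, colorSet, sw_symm, sw_left, sw_right, eq_comm]
    simp only [h2, ite_mul, zero_mul]
  exact {
    toBraidRel := braidRel_Y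
    unit := sum_ej hξ hd
    orth := fun i j => by
      rw [ej_mul_ej hξ hd]
      congr
    gmove := g_mul_ej
    sqn := fun a h j hj => by
      rw [hsq, if_neg (show ¬ j _ = j _ from hj), smul_zero, add_zero]
    sqy := fun a h j hj => by
      rw [hsq, if_pos (show j _ = j _ from hj), add_mul, ← Algebra.smul_def, smul_mul_assoc] }

end Colorings

section Regular

variable {𝕜 : Type} [Field 𝕜] {q ξ : 𝕜} {d : ℕ}

/-- The operator through which `g_a` acts on the regular-type representation attached to the
coloring `j`, whose basis is indexed by permutations. -/
def regG (q : 𝕜) (j : Fin n → ZMod d) (a : ℕ) (h : a + 1 < n) :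
    Module.End 𝕜 (Equiv.Perm (Fin n) →₀ 𝕜) :=
  Finsupp.linearCombination 𝕜 fun p =>
    if p ⟨a, by omega⟩ < p ⟨a + 1, h⟩ then Finsupp.single (p * YH.sw n a h) 1
    else q • Finsupp.single (p * YH.sw n a h) 1
      + if j (p ⟨a, by omega⟩) = j (p ⟨a + 1, h⟩) then (q - 1) • Finsupp.single p 1 else 0

/-- The operator through which `t_a` acts on the representation attached to `j`. -/
def regT (ξ : 𝕜) (j : Fin n → ZMod d) (a : Fin n) :
    Module.End 𝕜 (Equiv.Perm (Fin n) →₀ 𝕜) :=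
  Finsupp.linearCombination 𝕜 fun p => ξ ^ (j (p a)).val • Finsupp.single p 1

lemma regT_single (j : Fin n → ZMod d) (a : Fin n) (p : Equiv.Perm (Fin n)) :
    regT ξ j a (Finsupp.single p 1) = ξ ^ (j (p a)).val • Finsupp.single p 1 := by
  rw [regT, Finsupp.linearCombination_single, one_smul]

lemma regG_single (j : Fin n → ZMod d) (a : ℕ) (h : a + 1 < n) (p : Equiv.Perm (Fin n)) :
    regG q j a h (Finsupp.single p 1) =
      if p ⟨a, by omega⟩ < p ⟨a + 1, h⟩ then Finsupp.single (p * YH.sw n a h) 1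
      else q • Finsupp.single (p * YH.sw n a h) 1
        + if j (p ⟨a, by omega⟩) = j (p ⟨a + 1, h⟩) then (q - 1) • Finsupp.single p 1 else 0 := by
  rw [regG, Finsupp.linearCombination_single, one_smul]

lemma end_ext {φ ψ : Module.End 𝕜 (Equiv.Perm (Fin n) →₀ 𝕜)}
    (h : ∀ p, φ (Finsupp.single p 1) = ψ (Finsupp.single p 1)) : φ = ψ :=
  Finsupp.lhom_ext' fun p => LinearMap.ext_ring (h p)

lemma regT_pow (hξ : ξ ^ d = 1) (j : Fin n → ZMod d) (a : Fin n) : regT ξ j a ^ d = 1 :=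
  end_ext fun p => by
    have h := pow_smul_of_eigen (u := regT ξ j a) (c := ξ ^ (j (p a)).val)
      (m := (Finsupp.single p 1 : Equiv.Perm (Fin n) →₀ 𝕜)) (regT_single j a p) d
    rw [← pow_mul, mul_comm, pow_mul, hξ, one_pow, one_smul] at h
    exact h

lemma regT_comm (j : Fin n → ZMod d) (a b : Fin n) :
    regT ξ j a * regT ξ j b = regT ξ j b * regT ξ j a :=
  end_ext fun p => by
    simp only [Module.End.mul_apply, regT_single, map_smul]
    rw [smul_comm]

lemma regT_mul_regG (j : Fin n → ZMod d) (a : Fin n) (b : ℕ) (hb : b + 1 < n) :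
    regT ξ j a * regG q j b hb = regG q j b hb * regT ξ j (YH.sw n b hb a) :=
  end_ext fun p => by
    have h1 : regT ξ j a (Finsupp.single (p * YH.sw n b hb) 1)
        = ξ ^ (j (p (YH.sw n b hb a))).val • Finsupp.single (p * YH.sw n b hb) 1 :=
      regT_single j a _
    simp only [Module.End.mul_apply, regT_single, map_smul, regG_single]
    split_ifs with h2 h3
    · exact h1
    · have h4 : j (p (YH.sw n b hb a)) = j (p a) := by
        by_cases ha : (a : ℕ) = b
        · rw [show a = ⟨b, by omega⟩ from Fin.ext ha, sw_left, h3]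
        · by_cases ha' : (a : ℕ) = b + 1
          · rw [show a = ⟨b + 1, hb⟩ from Fin.ext ha', sw_right, h3]
          · rw [sw_of_ne b hb a ha ha']
      rw [map_add, map_smul, map_smul, h1, regT_single, h4, smul_add,
        smul_comm q, smul_comm (q - 1)]
    · rw [add_zero, map_smul, h1, smul_comm]

lemma regG_sq [NeZero d] (hξ : IsPrimitiveRoot ξ d) (hd : (d : 𝕜) ≠ 0)
    (j : Fin n → ZMod d) (a : ℕ) (h : a + 1 < n) :
    regG q j a h ^ 2 = algebraMap 𝕜 _ q + (q - 1) •
      (((d : 𝕜)⁻¹ • ∑ r ∈ Finset.range d,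
        regT ξ j ⟨a, by omega⟩ ^ r * regT ξ j ⟨a + 1, h⟩ ^ ((d - r) % d)) * regG q j a h) :=
  end_ext fun p => by
    have hE : ∀ p : Equiv.Perm (Fin n), ((d : 𝕜)⁻¹ • ∑ r ∈ Finset.range d,
        regT ξ j ⟨a, by omega⟩ ^ r * regT ξ j ⟨a + 1, h⟩ ^ ((d - r) % d)) (Finsupp.single p 1)
        = if j (p ⟨a, by omega⟩) = j (p ⟨a + 1, h⟩) then Finsupp.single p 1 else 0 := fun p =>
      eigenAgree_smul (u := regT ξ j ⟨a, by omega⟩) (w := regT ξ j ⟨a + 1, h⟩)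
        (m := (Finsupp.single p 1 : Equiv.Perm (Fin n) →₀ 𝕜)) hξ hd
        (regT_pow hξ.pow_eq_one j _) (regT_single j _ p) (regT_single j _ p)
    set E := ((d : 𝕜)⁻¹ • ∑ r ∈ Finset.range d,
        regT ξ j ⟨a, by omega⟩ ^ r * regT ξ j ⟨a + 1, h⟩ ^ ((d - r) % d))
    have e1 : (p * YH.sw n a h) ⟨a, by omega⟩ = p ⟨a + 1, h⟩ := by
      rw [Equiv.Perm.mul_apply, sw_left]
    have e2 : (p * YH.sw n a h) ⟨a + 1, h⟩ = p ⟨a, by omega⟩ := by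
      rw [Equiv.Perm.mul_apply, sw_right]
    have e3 : (j (p ⟨a + 1, h⟩) = j (p ⟨a, by omega⟩)) ↔
      j (p ⟨a, by omega⟩) = j (p ⟨a + 1, h⟩) := eq_comm
    have e4 : p ⟨a, by omega⟩ ≠ p ⟨a + 1, h⟩ := fun h' => by simpa using p.injective h'
    rw [sq, LinearMap.add_apply, LinearMap.smul_apply, Module.End.mul_apply,
      Module.End.mul_apply, Module.algebraMap_end_apply]
    rcases e4.lt_or_gt with hlt | hgt
    · simp only [regG_single, hE, e1, e2, e3, mul_sw_mul_sw, if_pos hlt, if_neg hlt.le.not_gt,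
        smul_ite, smul_zero]
    · simp only [regG_single, if_neg hgt.le.not_gt, map_add, map_smul, apply_ite (regG q j a h),
        apply_ite E, map_zero, e1, e2, e3, mul_sw_mul_sw, if_pos hgt, hE]
      split_ifs <;> module

lemma braidRel_reg (j : Fin n → ZMod d) : BraidRel (regG q j) where
  far a b ha hb hab := end_ext fun p => by
    have ca : ∀ (p : Equiv.Perm (Fin n)) (c : Fin n), (c = ⟨a, by omega⟩ ∨ c = ⟨a + 1, ha⟩) →
        (p * YH.sw n b hb) c = p c := fun p c hc => by
      rw [Equiv.Perm.mul_apply, sw_of_ne b hb c] <;> rcases hc with rfl | rfl <;> simp <;> omega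
    have cb : ∀ (p : Equiv.Perm (Fin n)) (c : Fin n), (c = ⟨b, by omega⟩ ∨ c = ⟨b + 1, hb⟩) →
        (p * YH.sw n a ha) c = p c := fun p c hc => by
      rw [Equiv.Perm.mul_apply, sw_of_ne a ha c] <;> rcases hc with rfl | rfl <;> simp <;> omega
    have hc : p * YH.sw n b hb * YH.sw n a ha = p * YH.sw n a ha * YH.sw n b hb := by
      rw [mul_assoc, mul_assoc, sw_comm a b ha hb hab]
    simp only [Module.End.mul_apply, regG_single]
    split_ifs <;> simp_all only [map_add, map_smul, regG_single, ca _ _ (Or.inl rfl),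
      ca _ _ (Or.inr rfl), cb _ _ (Or.inl rfl), cb _ _ (Or.inr rfl), if_true, if_false,
      add_zero] <;> module
  braid a h := end_ext fun p => by
    have hs : p * YH.sw n (a + 1) h * YH.sw n a (by omega) * YH.sw n (a + 1) h
        = p * YH.sw n a (by omega) * YH.sw n (a + 1) h * YH.sw n a (by omega) := by
      simp only [mul_assoc, ← sw_braid a h]
    have v1 : YH.sw n a (by omega) ⟨a + 2, h⟩ = ⟨a + 2, h⟩ :=
      sw_of_ne _ _ _ (by simp) (by simp)
    have v2 : YH.sw n (a + 1) h ⟨a, by omega⟩ = ⟨a, by omega⟩ :=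
      sw_of_ne _ _ _ (by simp) (by simp only; omega)
    have v3 : YH.sw n a (by omega) ⟨a + 1 + 1, h⟩ = ⟨a + 1 + 1, h⟩ := v1
    have hxy : p ⟨a, by omega⟩ ≠ p ⟨a + 1, by omega⟩ := fun h' => by simpa using p.injective h'
    have hyz : p ⟨a + 1, by omega⟩ ≠ p ⟨a + 1 + 1, h⟩ := fun h' => by simpa using p.injective h'
    have hxz : p ⟨a, by omega⟩ ≠ p ⟨a + 1 + 1, h⟩ := fun h' => by
      have := p.injective h'
      simp at this
      omega
    simp only [Module.End.mul_apply, regG_single, apply_ite (regG q j _ _), map_add, map_smul,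
      map_zero, Equiv.Perm.mul_apply, sw_left, sw_right, v2, v3, mul_sw_mul_sw, hs]
    generalize p ⟨a, by omega⟩ = x at *
    generalize p ⟨a + 1, by omega⟩ = y at *
    generalize p ⟨a + 1 + 1, h⟩ = z at *
    have e1 : j y = j x ↔ j x = j y := eq_comm
    have e3 : j z = j y ↔ j y = j z := eq_comm
    have i1 : y < x ↔ ¬ x < y := by grind
    have i3 : z < y ↔ ¬ y < z := by grind
    simp only [e1, e3, i1, i3]
    have c1 : x < y → y < z → x < z := lt_trans
    have c2 : ¬ x < y → ¬ y < z → ¬ x < z := by grind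
    have d1 : j x = j y → j y = j z → j x = j z := Eq.trans
    have d2 : j x = j y → j x = j z → j y = j z := fun h h' => h.symm.trans h'
    have d3 : j x = j z → j y = j z → j x = j y := fun h h' => h.trans h'.symm
    by_cases l1 : x < y <;> by_cases l2 : y < z <;> by_cases l3 : x < z <;>
      by_cases m1 : j x = j y <;> by_cases m2 : j y = j z <;> by_cases m3 : j x = j z <;>
      simp only [l1, l2, l3, m1, m2, m3, if_true, if_false, not_true, not_false_iff] <;>
      first
      | module
      | exact absurd (c1 l1 l2) l3
      | exact absurd l3 (c2 l1 l2)
      | exact absurd (d1 m1 m2) m3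
      | exact absurd (d2 m1 m3) m2
      | exact absurd (d3 m3 m2) m1
      | (simp only [if_neg (show ¬ j z = j y from fun h' => m2 h'.symm)] <;> module)

/-- The operators of the representation attached to `j`. -/
def regGen (ξ q : 𝕜) (j : Fin n → ZMod d) :
    YH.Gen n → Module.End 𝕜 (Equiv.Perm (Fin n) →₀ 𝕜)
  | .g a h => regG q j a h
  | .t a => regT ξ j a

/-- The representation of `Y_{d,n}(q)` attached to the coloring `j`. -/
def regRep [NeZero d] (hξ : IsPrimitiveRoot ξ d) (hd : (d : 𝕜) ≠ 0) (q : 𝕜)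
    (j : Fin n → ZMod d) :
    YH.Y 𝕜 d n q →ₐ[𝕜] Module.End 𝕜 (Equiv.Perm (Fin n) →₀ 𝕜) :=
  RingQuot.liftAlgHom 𝕜 ⟨FreeAlgebra.lift 𝕜 (regGen ξ q j), fun {x y} hxy => by
      induction hxy with
      | torder a => simpa [YH.T, regGen] using regT_pow hξ.pow_eq_one j a
      | tcomm a b => simpa [YH.T, regGen] using regT_comm j a b
      | tg a b hb => simpa [YH.T, YH.G, regGen] using regT_mul_regG j a b hb
      | quad a h => simpa [YH.T, YH.G, YH.Efree, regGen] using regG_sq hξ hd j a h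
      | braid a h => simpa [YH.G, regGen] using (braidRel_reg (q := q) j).braid a h
      | gcomm a b ha hb hab => simpa [YH.G, regGen] using (braidRel_reg (q := q) j).far a b ha hb hab⟩

lemma regRep_g [NeZero d] (hξ : IsPrimitiveRoot ξ d) (hd : (d : 𝕜) ≠ 0)
    (j : Fin n → ZMod d) (a : ℕ) (h : a + 1 < n) :
    regRep hξ hd q j (YH.g 𝕜 d n q a h) = regG q j a h := by
  simp [regRep, YH.g, YH.π, YH.G, regGen]

lemma regRep_t [NeZero d] (hξ : IsPrimitiveRoot ξ d) (hd : (d : 𝕜) ≠ 0)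
    (j : Fin n → ZMod d) (a : Fin n) :
    regRep hξ hd q j (YH.t 𝕜 d n q a) = regT ξ j a := by
  simp [regRep, YH.t, YH.π, YH.T, regGen]

lemma regRep_braidLift [NeZero d] (hξ : IsPrimitiveRoot ξ d) (hd : (d : 𝕜) ≠ 0)
    (j : Fin n → ZMod d) (p : Equiv.Perm (Fin n)) :
    regRep hξ hd q j (braidLift (YH.g 𝕜 d n q) p) (Finsupp.single 1 1) = Finsupp.single p 1 := by
  induction p using perm_induction with
  | one => rw [braidLift_one, map_one, Module.End.one_apply]
  | step p a h hlt ih =>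
    rw [braidLift_mul_sw braidRel_Y p a h hlt, map_mul, Module.End.mul_apply, ih, regRep_g,
      regG_single, if_pos hlt]

lemma regRep_ej [NeZero d] (hξ : IsPrimitiveRoot ξ d) (hd : (d : 𝕜) ≠ 0)
    (j i : Fin n → ZMod d) :
    regRep hξ hd q j (YH.ej 𝕜 d n q ξ i) (Finsupp.single 1 1)
      = if i = j then Finsupp.single 1 1 else 0 := by
  rw [ej_eq_prod, map_list_prod, List.map_map]
  have h := prod_eigenProj_smul hξ hd (u := regT ξ j)
    (m := (Finsupp.single 1 1 : Equiv.Perm (Fin n) →₀ 𝕜)) (fun a => regT_single j a 1) i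
  have e : (regRep hξ hd q j) ∘ (fun a => eigenProj ξ (YH.t 𝕜 d n q a) (i a))
      = fun a => eigenProj ξ (regT ξ j a) (i a) := funext fun a => by
    rw [Function.comp_apply, ← regRep_t hξ hd]
    exact map_eigenProj (A := YH.Y 𝕜 d n q)
      (B := Module.End 𝕜 (Equiv.Perm (Fin n) →₀ 𝕜)) (regRep hξ hd q j) (YH.t 𝕜 d n q a) (i a)
  rw [e]
  exact h.trans (by congr)

/-- A homomorphism to `Y_{d,n}(q)` compatible with the generators `g_a`, and sending the
idempotents `e x` to sums of `e(j)` over the nonempty fibers of a map `f`, is injective. -/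
lemma injective_of_fiber_sums [NeZero d] (hξ : IsPrimitiveRoot ξ d) (hd : (d : 𝕜) ≠ 0)
    {X : Type} [Fintype X] {R : Type*} [Ring R] [Algebra 𝕜 R] {P : PermSet n X}
    {g : ∀ a : ℕ, a + 1 < n → R} {e : X → R} (S : BTSystem P q g e)
    (hgen : ∀ B : Subalgebra 𝕜 R, (∀ a h, g a h ∈ B) → (∀ x, e x ∈ B) → B = ⊤)
    (f : (Fin n → ZMod d) → X) (hf : Function.Surjective f)
    (φ : R →ₐ[𝕜] YH.Y 𝕜 d n q) (hg : ∀ a h, φ (g a h) = YH.g 𝕜 d n q a h)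
    (he : ∀ x, φ (e x) = ∑ j ∈ Finset.univ.filter (fun j => f j = x), YH.ej 𝕜 d n q ξ j) :
    Function.Injective φ := by
  choose s hs using hf
  rw [injective_iff_map_eq_zero]
  intro r hr
  refine S.injective_of_separating hgen
    (fun x => (LinearMap.applyₗ (Finsupp.single 1 1 : Equiv.Perm (Fin n) →₀ 𝕜)).comp
      ((regRep hξ hd q (s x)).toLinearMap.comp φ.toLinearMap)) (fun x p y => ?_) r fun x => ?_
  · simp only [LinearMap.comp_apply, AlgHom.toLinearMap_apply, LinearMap.applyₗ_apply_apply,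
      map_mul, he, map_sum, Module.End.mul_apply, LinearMap.sum_apply, regRep_ej]
    rw [map_braidLift S.toBraidRel braidRel_Y φ hg, ← map_sum, Finset.sum_ite_eq']
    simp only [Finset.mem_filter, Finset.mem_univ, true_and, hs]
    split_ifs
    · exact regRep_braidLift hξ hd _ p
    · exact map_zero _
  · simp [hr]

end Regular

section Partitions

variable (n) in
/-- The `S_n`-set of ordered set partitions. -/
def ordSet : PermSet n (BTO.OrdSetPar n) where
  act := BTO.ordPerm
  act_one _ := rfl
  act_mul _ _ _ := rfl
  rel A a b := A.1 a = A.1 b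

variable (n) in
/-- The `S_n`-set of set partitions. -/
def parSet : PermSet n (Setoid (Fin n)) where
  act := YH.permSetoid n
  act_one _ := rfl
  act_mul _ _ _ := rfl
  rel A a b := A.r a b

lemma le_of_lt_imp_lt (A B : BTO.OrdSetPar n) (h : ∀ x y, A.1 x < A.1 y → B.1 x < B.1 y)
    (x : Fin n) : A.1 x ≤ B.1 x := by
  suffices ∀ m : ℕ, ∀ x, (A.1 x : ℕ) = m → m ≤ B.1 x from this _ x rfl
  intro m
  induction m with
  | zero => exact fun _ _ => Nat.zero_le _
  | succ m ih =>
    intro x hx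
    obtain ⟨y, hy⟩ := A.2 m ⟨x, hx⟩
    have h1 := ih y hy
    have h2 : (B.1 y : ℕ) < B.1 x := h y x (show (A.1 y : ℕ) < A.1 x by omega)
    omega

lemma ordSetPar_ext {A B : BTO.OrdSetPar n} (h : ∀ x y, A.1 x < A.1 y ↔ B.1 x < B.1 y) : A = B :=
  Subtype.ext (funext fun x => le_antisymm (le_of_lt_imp_lt A B (fun x y => (h x y).1) x)
    (le_of_lt_imp_lt B A (fun x y => (h x y).2) x))

variable {d : ℕ}

/-- The values of the coloring `j` below the value at `x`. -/
def colorsBelow (j : Fin n → ZMod d) (x : Fin n) : Finset (ZMod d) :=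
  (Finset.univ.image j).filter fun c => c.val < (j x).val

lemma card_colorsBelow_lt (j : Fin n → ZMod d) (x : Fin n) : (colorsBelow j x).card < n := by
  calc (colorsBelow j x).card < (Finset.univ.image j).card := by
        refine Finset.card_lt_card ((Finset.filter_ssubset).2 ⟨j x, ?_, lt_irrefl _⟩)
        exact Finset.mem_image_of_mem j (Finset.mem_univ x)
    _ ≤ n := Finset.card_image_le.trans (Finset.card_fin n).le

lemma card_colorsBelow_lt_iff (j : Fin n → ZMod d) (x y : Fin n) :
    (colorsBelow j x).card < (colorsBelow j y).card ↔ (j x).val < (j y).val := by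
  have hle : ∀ x y, (j x).val ≤ (j y).val → (colorsBelow j x).card ≤ (colorsBelow j y).card :=
    fun x y h => Finset.card_le_card
      (Finset.monotone_filter_right _ fun c _ hc => lt_of_lt_of_le hc h)
  refine ⟨fun h => lt_of_not_ge fun h' => h.not_ge (hle _ _ h'), fun h => ?_⟩
  refine Finset.card_lt_card (Finset.ssubset_iff_of_subset
    (Finset.monotone_filter_right _ fun c _ hc => lt_trans hc h) |>.2 ⟨j x, ?_, ?_⟩)
  · exact Finset.mem_filter.2 ⟨Finset.mem_image_of_mem j (Finset.mem_univ x), h⟩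
  · exact fun hx => lt_irrefl _ (Finset.mem_filter.1 hx).2

/-- The ordered set partition into the fibers of a coloring, ordered by color. -/
def fibers [NeZero d] (j : Fin n → ZMod d) : BTO.OrdSetPar n :=
  ⟨fun x => ⟨(colorsBelow j x).card, card_colorsBelow_lt j x⟩, by
    rintro m ⟨x, hx⟩
    simp only at hx ⊢
    obtain ⟨c, hc, hmax⟩ := (colorsBelow j x).exists_max_image ZMod.val
      (Finset.card_pos.1 (by omega))
    obtain ⟨hc1, hc2⟩ := Finset.mem_filter.1 hc
    obtain ⟨y, -, rfl⟩ := Finset.mem_image.1 hc1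
    refine ⟨y, ?_⟩
    have : colorsBelow j y = (colorsBelow j x).erase (j y) := by
      ext c
      simp only [Finset.mem_erase, colorsBelow, Finset.mem_filter]
      constructor
      · exact fun ⟨h1, h2⟩ => ⟨fun h => lt_irrefl _ (h ▸ h2), h1, h2.trans hc2⟩
      · refine fun ⟨h1, h2, h3⟩ => ⟨h2, lt_of_le_of_ne
          (hmax c (Finset.mem_filter.2 ⟨h2, h3⟩)) fun h => h1 (ZMod.val_injective d h)⟩
    rw [this, Finset.card_erase_of_mem hc, hx, Nat.add_sub_cancel]⟩

lemma fibers_lt_iff [NeZero d] (j : Fin n → ZMod d) (x y : Fin n) :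
    (fibers j).1 x < (fibers j).1 y ↔ (j x).val < (j y).val :=
  card_colorsBelow_lt_iff j x y

lemma fibers_eq_iff [NeZero d] (j : Fin n → ZMod d) (x y : Fin n) :
    (fibers j).1 x = (fibers j).1 y ↔ j x = j y := by
  rw [← (ZMod.val_injective d).eq_iff, eq_iff_le_not_lt, eq_iff_le_not_lt, ← not_lt, ← not_lt,
    fibers_lt_iff, fibers_lt_iff]

lemma fibers_act [NeZero d] (σ : Equiv.Perm (Fin n)) (j : Fin n → ZMod d) :
    fibers ((colorSet n d).act σ j) = (ordSet n).act σ (fibers j) :=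
  ordSetPar_ext fun x y => by
    rw [fibers_lt_iff]
    exact (fibers_lt_iff j (σ.symm x) (σ.symm y)).symm

lemma mem_JOrd_iff [NeZero d] (j : Fin n → ZMod d) (A : BTO.OrdSetPar n) :
    j ∈ BTO.JOrd d A ↔ fibers j = A := by
  simp only [BTO.JOrd, Finset.mem_filter, Finset.mem_univ, true_and]
  constructor
  · rintro ⟨h1, -, h3⟩
    refine ordSetPar_ext fun x y => ?_
    rw [fibers_lt_iff]
    refine ⟨fun h => ?_, h3 x y⟩
    rcases lt_trichotomy (A.1 x) (A.1 y) with h' | h' | h'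
    · exact h'
    · rw [h1 x y h'] at h
      exact absurd h (lt_irrefl _)
    · exact absurd h (h3 y x h').not_gt
  · rintro rfl
    exact ⟨fun x y => (fibers_eq_iff j x y).1, fun x y => (not_congr (fibers_eq_iff j x y)).1,
      fun x y => (fibers_lt_iff j x y).1⟩

lemma val_fin_cast (hdn : n ≤ d) (x : Fin n) : (((x : ℕ) : ZMod d)).val = x :=
  ZMod.val_cast_of_lt (x.2.trans_le hdn)

lemma fibers_surjective [NeZero d] (hdn : n ≤ d) :
    Function.Surjective (fibers : (Fin n → ZMod d) → BTO.OrdSetPar n) := fun A =>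
  ⟨fun x => ((A.1 x : ℕ) : ZMod d), ordSetPar_ext fun x y => by
    rw [fibers_lt_iff, val_fin_cast hdn, val_fin_cast hdn, Fin.lt_def]⟩

lemma toSetoid_fibers_surjective [NeZero d] (hdn : n ≤ d) : Function.Surjective
    fun j : Fin n → ZMod d => BTO.toSetoid (fibers j) := fun A => by
  refine ⟨fun x => (((Quotient.mk A x).out : ℕ) : ZMod d), Setoid.ext fun x y => ?_⟩
  refine (fibers_eq_iff _ x y).trans ?_
  rw [← (ZMod.val_injective d).eq_iff, val_fin_cast hdn, val_fin_cast hdn, ← Fin.ext_iff,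
    Quotient.out_inj, Quotient.eq]

end Partitions

section Presentations

variable {𝕜 : Type} [Field 𝕜] {q : 𝕜}

lemma ringQuot_subalgebra_eq_top {G : Type} {r : FreeAlgebra 𝕜 G → FreeAlgebra 𝕜 G → Prop}
    (B : Subalgebra 𝕜 (RingQuot r))
    (h : ∀ x, RingQuot.mkAlgHom 𝕜 r (FreeAlgebra.ι 𝕜 x) ∈ B) : B = ⊤ := by
  have h1 : B.comap (RingQuot.mkAlgHom 𝕜 r) = ⊤ := by
    rw [eq_top_iff, ← FreeAlgebra.adjoin_range_ι, Algebra.adjoin_le_iff]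
    rintro _ ⟨x, rfl⟩
    exact h x
  refine eq_top_iff.2 fun y _ => ?_
  obtain ⟨x, rfl⟩ := RingQuot.mkAlgHom_surjective 𝕜 r y
  exact (h1 ▸ Algebra.mem_top : x ∈ B.comap (RingQuot.mkAlgHom 𝕜 r))

lemma ord_subalgebra_eq_top (B : Subalgebra 𝕜 (BTO.E 𝕜 n q)) (hg : ∀ a h, BTO.g 𝕜 n q a h ∈ B)
    (he : ∀ A, BTO.ebar 𝕜 n q A ∈ B) : B = ⊤ :=
  ringQuot_subalgebra_eq_top B fun
    | .g a h => hg a h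
    | .eo A => he A

lemma par_subalgebra_eq_top (B : Subalgebra 𝕜 (BTP.E 𝕜 n q)) (hg : ∀ a h, BTP.g 𝕜 n q a h ∈ B)
    (he : ∀ A, BTP.ebar 𝕜 n q A ∈ B) : B = ⊤ :=
  ringQuot_subalgebra_eq_top B fun
    | .g a h => hg a h
    | .eb A => he A

lemma ord_mk_rel {x y : BTO.F 𝕜 n} (h : BTO.Rel 𝕜 n q x y) : BTO.π 𝕜 n q x = BTO.π 𝕜 n q y :=
  RingQuot.mkAlgHom_rel 𝕜 h

lemma par_mk_rel {x y : BTP.F 𝕜 n} (h : BTP.Rel 𝕜 n q x y) : BTP.π 𝕜 n q x = BTP.π 𝕜 n q y :=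
  RingQuot.mkAlgHom_rel 𝕜 h

lemma btSystem_ord : BTSystem (ordSet n) q (BTO.g 𝕜 n q) (BTO.ebar 𝕜 n q) where
  braid a h := by simpa only [BTO.g, BTO.ebar, map_mul] using ord_mk_rel (BTO.Rel.braid (q := q) a h)
  far a b ha hb hab := by
    simpa only [BTO.g, BTO.ebar, map_mul] using ord_mk_rel (BTO.Rel.gfar (q := q) a b ha hb hab)
  unit := by simpa only [BTO.g, BTO.ebar, map_sum, map_one] using ord_mk_rel (BTO.Rel.unit (q := q))
  orth A C := by
    have := ord_mk_rel (BTO.Rel.orth (q := q) A C)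
    rw [map_mul, apply_ite (BTO.π 𝕜 n q), map_zero] at this
    exact this.trans (by congr)
  gmove a h A := by simpa only [BTO.g, BTO.ebar, map_mul, ordSet] using ord_mk_rel (BTO.Rel.gmove (q := q) a h A)
  sqn a h A hA := by
    simpa only [BTO.g, BTO.ebar, map_mul, map_pow, map_smul] using ord_mk_rel (BTO.Rel.sqn (q := q) a h A hA)
  sqy a h A hA := by
    simpa only [BTO.g, BTO.ebar, map_mul, map_pow, map_add, map_smul, AlgHom.commutes] using
      ord_mk_rel (BTO.Rel.sqy (q := q) a h A hA)

lemma btSystem_par : BTSystem (parSet n) q (BTP.g 𝕜 n q) (BTP.ebar 𝕜 n q) where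
  braid a h := by simpa only [BTP.g, BTP.ebar, map_mul] using par_mk_rel (BTP.Rel.braid (q := q) a h)
  far a b ha hb hab := by
    simpa only [BTP.g, BTP.ebar, map_mul] using par_mk_rel (BTP.Rel.gfar (q := q) a b ha hb hab)
  unit := by simpa only [BTP.g, BTP.ebar, map_sum, map_one] using par_mk_rel (BTP.Rel.unit (q := q))
  orth A C := by
    have := par_mk_rel (BTP.Rel.orth (q := q) A C)
    rw [map_mul, apply_ite (BTP.π 𝕜 n q), map_zero] at this
    exact this.trans (by congr)
  gmove a h A := by simpa only [BTP.g, BTP.ebar, map_mul, parSet] using par_mk_rel (BTP.Rel.gmove (q := q) a h A)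
  sqn a h A hA := by
    simpa only [BTP.g, BTP.ebar, map_mul, map_pow, map_smul] using par_mk_rel (BTP.Rel.sqn (q := q) a h A hA)
  sqy a h A hA := by
    simpa only [BTP.g, BTP.ebar, map_mul, map_pow, map_add, map_smul, AlgHom.commutes] using
      par_mk_rel (BTP.Rel.sqy (q := q) a h A hA)

variable {R : Type} [Ring R] [Algebra 𝕜 R] {g : ∀ a : ℕ, a + 1 < n → R}

/-- The images of the generators of `E^ord_n(q)` under a homomorphism. -/
def ordGen (g : ∀ a : ℕ, a + 1 < n → R) (e : BTO.OrdSetPar n → R) : BTO.Gen n → R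
  | .g a h => g a h
  | .eo A => e A

/-- The images of the generators of `E′_n(q)` under a homomorphism. -/
def parGen (g : ∀ a : ℕ, a + 1 < n → R) (e : Setoid (Fin n) → R) : BTP.Gen n → R
  | .g a h => g a h
  | .eb A => e A

lemma exists_ord_lift {e : BTO.OrdSetPar n → R} (S : BTSystem (ordSet n) q g e) :
    ∃ φ : BTO.E 𝕜 n q →ₐ[𝕜] R, (∀ a h, φ (BTO.g 𝕜 n q a h) = g a h) ∧
      ∀ A, φ (BTO.ebar 𝕜 n q A) = e A := by
  refine ⟨RingQuot.liftAlgHom 𝕜 ⟨FreeAlgebra.lift 𝕜 (ordGen g e), fun {x y} hxy => ?_⟩,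
    fun a h => by simp [BTO.g, BTO.π, BTO.G, ordGen],
    fun A => by simp [BTO.ebar, BTO.π, BTO.EO, ordGen]⟩
  induction hxy with
  | unit => simpa [BTO.EO, ordGen] using S.unit
  | orth A C =>
    rw [map_mul, apply_ite (FreeAlgebra.lift 𝕜 (ordGen g e)), map_zero]
    simp only [BTO.EO, FreeAlgebra.lift_ι_apply, ordGen]
    exact (S.orth A C).trans (by congr)
  | gmove a h A => simpa [BTO.EO, BTO.G, ordGen, ordSet] using S.gmove a h A
  | sqn a h A hA => simpa [BTO.EO, BTO.G, ordGen] using S.sqn a h A hA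
  | sqy a h A hA => simpa [BTO.EO, BTO.G, ordGen] using S.sqy a h A hA
  | braid a h => simpa [BTO.G, ordGen] using S.braid a h
  | gfar a b ha hb hab => simpa [BTO.G, ordGen] using S.far a b ha hb hab

lemma exists_par_lift {e : Setoid (Fin n) → R} (S : BTSystem (parSet n) q g e) :
    ∃ φ : BTP.E 𝕜 n q →ₐ[𝕜] R, (∀ a h, φ (BTP.g 𝕜 n q a h) = g a h) ∧
      ∀ A, φ (BTP.ebar 𝕜 n q A) = e A := by
  refine ⟨RingQuot.liftAlgHom 𝕜 ⟨FreeAlgebra.lift 𝕜 (parGen g e), fun {x y} hxy => ?_⟩,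
    fun a h => by simp [BTP.g, BTP.π, BTP.G, parGen],
    fun A => by simp [BTP.ebar, BTP.π, BTP.EB, parGen]⟩
  induction hxy with
  | unit => simpa [BTP.EB, parGen] using S.unit
  | orth A C =>
    rw [map_mul, apply_ite (FreeAlgebra.lift 𝕜 (parGen g e)), map_zero]
    simp only [BTP.EB, FreeAlgebra.lift_ι_apply, parGen]
    exact (S.orth A C).trans (by congr)
  | gmove a h A => simpa [BTP.EB, BTP.G, parGen, parSet] using S.gmove a h A
  | sqn a h A hA => simpa [BTP.EB, BTP.G, parGen] using S.sqn a h A hA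
  | sqy a h A hA => simpa [BTP.EB, BTP.G, parGen] using S.sqy a h A hA
  | braid a h => simpa [BTP.G, parGen] using S.braid a h
  | gfar a b ha hb hab => simpa [BTP.G, parGen] using S.far a b ha hb hab

end Presentations

end BTAux

/-- suppose `d ≥ n`, `d` is invertible in `𝕜` and `𝕜` contains a primitive
`d`-th root of unity `ξ`. Then:
(a) there is an injective `𝕜`-algebra homomorphism `ε : E^ord_n(q) → Y_{d,n}(q)` with
`ε(g_a) = g_a` and `ε(ē(A^ord)) = Σ_{j ∈ J_{A^ord}} e(j)`; and
(b) there is an injective `𝕜`-algebra homomorphism `ε₁ : E′_n(q) → E^ord_n(q)` with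
`ε₁(g_a) = g_a` and `ε₁(ē(A)) = Σ ē(B^ord)`, the sum over the ordered set partitions with
underlying set partition `A`. -/
theorem statement14 (𝕜 : Type) [Field 𝕜] (d n : ℕ) [NeZero d] (hdn : n ≤ d)
    (hdk : (d : 𝕜) ≠ 0) (q : 𝕜) (hq0 : q ≠ 0) (hq1 : q ≠ 1)
    (ξ : 𝕜) (hξ : IsPrimitiveRoot ξ d) :
    (∃ ε : BTO.E 𝕜 n q →ₐ[𝕜] YH.Y 𝕜 d n q,
      Function.Injective ε
      ∧ (∀ (a : ℕ) (h : a + 1 < n), ε (BTO.g 𝕜 n q a h) = YH.g 𝕜 d n q a h)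
      ∧ (∀ A : BTO.OrdSetPar n,
          ε (BTO.ebar 𝕜 n q A) = ∑ j ∈ BTO.JOrd d A, YH.ej 𝕜 d n q ξ j))
    ∧ (∃ ε₁ : BTP.E 𝕜 n q →ₐ[𝕜] BTO.E 𝕜 n q,
      Function.Injective ε₁
      ∧ (∀ (a : ℕ) (h : a + 1 < n), ε₁ (BTP.g 𝕜 n q a h) = BTO.g 𝕜 n q a h)
      ∧ (∀ A : Setoid (Fin n),
          ε₁ (BTP.ebar 𝕜 n q A)
            = ∑ C ∈ Finset.univ.filter (fun C : BTO.OrdSetPar n => BTO.toSetoid C = A),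
                BTO.ebar 𝕜 n q C)) := by
  obtain ⟨ε, hεg, hεe⟩ := BTAux.exists_ord_lift
    ((BTAux.btSystem_Y (q := q) hξ hdk).pushforward (BTAux.ordSet n) BTAux.fibers
      BTAux.fibers_act BTAux.fibers_eq_iff)
  obtain ⟨ε₁, hε₁g, hε₁e⟩ := BTAux.exists_par_lift
    ((BTAux.btSystem_ord (𝕜 := 𝕜) (q := q)).pushforward (BTAux.parSet n) BTO.toSetoid
      (fun _ _ => rfl) (fun _ _ _ => Iff.rfl))
  refine ⟨⟨ε, ?_, hεg, fun A => ?_⟩, ε₁, ?_, hε₁g, fun A => ?_⟩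
  · exact BTAux.injective_of_fiber_sums hξ hdk BTAux.btSystem_ord BTAux.ord_subalgebra_eq_top
      BTAux.fibers (BTAux.fibers_surjective hdn) ε hεg hεe
  · rw [hεe]
    refine Finset.sum_congr (Finset.ext fun j => ?_) fun _ _ => rfl
    rw [BTAux.mem_JOrd_iff, Finset.mem_filter, and_iff_right (Finset.mem_univ j)]
  · refine Function.Injective.of_comp (f := ε) (BTAux.injective_of_fiber_sums hξ hdk
      BTAux.btSystem_par BTAux.par_subalgebra_eq_top (fun j => BTO.toSetoid (BTAux.fibers j))
      (BTAux.toSetoid_fibers_surjective hdn) (ε.comp ε₁) (fun a h => ?_) fun A => ?_)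
    · rw [AlgHom.comp_apply, hε₁g, hεg]
    · rw [AlgHom.comp_apply, hε₁e, map_sum]
      simp only [hεe]
      rw [← Finset.sum_fiberwise_of_maps_to (g := BTAux.fibers)
        (t := Finset.univ.filter fun C : BTO.OrdSetPar n => BTO.toSetoid C = A)
        fun j hj => by simpa using hj]
      refine Finset.sum_congr rfl fun C hC => Finset.sum_congr (Finset.ext fun j => ?_)
        fun _ _ => rfl
      simp only [Finset.mem_filter, Finset.mem_univ, true_and] at hC ⊢
      exact ⟨fun h => ⟨h ▸ hC, h⟩, And.right⟩
  · rw [hε₁e]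

end
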